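/- arXiv:2010.15744 — 2 statements merged into one kernel-verified Lean document; each statement's English description precedes it below -/
import Mathlib

section
/- Fix a positive integer n and an integer b with 0 ≤ b < 3n. Let L ⊆ U_{n,b}(ℤ) be defined by finitely many congruence conditions: for some integer m ≥ 1 and some subset S ⊆ (ℤ/mℤ)², L = {nx³ + bx²y + cxy² + dy³ : (c mod m, d mod m) ∈ S}, and set ν(L) := #S/m². Let N⁺(L; n, X) (resp. N⁻(L; n, X)) denote the number of generic forms f ∈ L with Δ(f) > 0 (resp. Δ(f) < 0) and H(f) < X. Then for every ε > 0: N⁺(L; n, X) = (8/(405·n^{4/3}))·ν(L)·X^{5/6} + O_ε(X^{1/2+ε}) and N⁻(L; n, X) = (32/(405·n^{4/3}))·ν(L)·X^{5/6} + O_ε(X^{1/2+ε}). -/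
/-!
Statement 14: counting generic binary cubic forms with fixed leading coefficient `n`
and `x²y`-coefficient `b` in a set defined by finitely many congruence conditions.
-/

open Polynomial

noncomputable section

/-- The discriminant of the binary cubic form `nx³ + bx²y + cxy² + dy³`. -/
def discForm (n b c d : ℤ) : ℤ :=
  b ^ 2 * c ^ 2 - 4 * n * c ^ 3 - 4 * b ^ 3 * d - 27 * n ^ 2 * d ^ 2
    + 18 * n * b * c * d

/-- The invariant `I(f) = b² - 3nc`. -/
def Iform (n b c : ℤ) : ℤ := b ^ 2 - 3 * n * c

/-- The invariant `J(f) = -2b³ + 9nbc - 27n²d`. -/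
def Jform (n b c d : ℤ) : ℤ := -2 * b ^ 3 + 9 * n * b * c - 27 * n ^ 2 * d

/-- The height `H(f) = n⁻²·max{|I(f)|³, J(f)²/4}`. -/
def htForm (n b c d : ℤ) : ℝ :=
  ((n : ℝ) ^ 2)⁻¹ * max (|(Iform n b c : ℝ)| ^ 3) ((Jform n b c d : ℝ) ^ 2 / 4)

/-- The dehomogenization `f(x, 1)`, as a polynomial over `ℚ`. -/
def cubicPoly (n b c d : ℤ) : ℚ[X] :=
  C (n : ℚ) * X ^ 3 + C (b : ℚ) * X ^ 2 + C (c : ℚ) * X + C (d : ℚ)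

/-- A form is generic if it is irreducible over `ℚ` and the Galois group of its
splitting field is `S₃`, i.e. its splitting field has degree 6. -/
def GenericForm (n b c d : ℤ) : Prop :=
  Irreducible (cubicPoly n b c d) ∧
    Module.finrank ℚ (cubicPoly n b c d).SplittingField = 6

/-- The number of generic forms `nx³ + bx²y + cxy² + dy³` with
`(c mod m, d mod m) ∈ S`, sign condition `0 < s·Δ(f)` and height `H(f) < X`. -/
def NCong (n : ℕ) (b : ℤ) (m : ℕ) (S : Set (ZMod m × ZMod m)) (s : ℤ) (X : ℝ) : ℕ :=
  Set.ncard {t : ℤ × ℤ |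
    ((t.1 : ZMod m), (t.2 : ZMod m)) ∈ S ∧
    GenericForm n b t.1 t.2 ∧ 0 < s * discForm n b t.1 t.2 ∧
    htForm n b t.1 t.2 < X}

theorem exists_succ_pow_le_mul_two_pow (k : ℕ) :
    ∃ C : ℕ, 0 < C ∧ ∀ a : ℕ, (a + 1) ^ k ≤ C * 2 ^ a := by
  obtain ⟨B, hB⟩ := (tendsto_pow_const_div_const_pow_of_one_lt k
    (r := (2 : ℝ)) (by norm_num)).bddAbove_range
  obtain ⟨C, hC⟩ := exists_nat_gt B
  refine ⟨2 * C + 1, by omega, fun a => ?_⟩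
  have h1 : ((a + 1 : ℕ) : ℝ) ^ k / 2 ^ (a + 1) ≤ B := hB ⟨a + 1, rfl⟩
  rw [div_le_iff₀ (by positivity), pow_succ] at h1
  have h2 : (0 : ℝ) < 2 ^ a := by positivity
  have h3 : ((a + 1 : ℕ) : ℝ) ^ k ≤ (2 * C + 1) * 2 ^ a := by nlinarith
  exact_mod_cast h3

theorem exists_card_divisors_pow_le (k : ℕ) :
    ∃ C : ℕ, ∀ n : ℕ, n ≠ 0 → n.divisors.card ^ k ≤ C * n := by
  obtain ⟨C, hC0, hC⟩ := exists_succ_pow_le_mul_two_pow k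
  refine ⟨C ^ (2 ^ k), fun n hn => ?_⟩
  have key : ∀ p ∈ n.primeFactors, (n.factorization p + 1) ^ k ≤
      (if p < 2 ^ k then C else 1) * p ^ n.factorization p := by
    intro p hp
    have hp2 : 2 ≤ p := (Nat.prime_of_mem_primeFactors hp).two_le
    split_ifs with h
    · exact (hC _).trans (Nat.mul_le_mul_left _ (Nat.pow_le_pow_left hp2 _))
    · rw [one_mul]
      calc (n.factorization p + 1) ^ k ≤ (2 ^ n.factorization p) ^ k :=
            Nat.pow_le_pow_left (Nat.lt_two_pow_self) _
        _ = (2 ^ k) ^ n.factorization p := by rw [← pow_mul, ← pow_mul, mul_comm]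
        _ ≤ p ^ n.factorization p := Nat.pow_le_pow_left (not_lt.mp h) _
  rw [Nat.card_divisors hn, ← Finset.prod_pow]
  refine (Finset.prod_le_prod' key).trans ?_
  rw [Finset.prod_mul_distrib]
  have h1 : ∏ p ∈ n.primeFactors, p ^ n.factorization p = n :=
    Nat.prod_factorization_pow_eq_self hn
  rw [h1]
  refine Nat.mul_le_mul_right _ ?_
  rw [← Finset.prod_filter, Finset.prod_const]
  refine Nat.pow_le_pow_right hC0 ?_
  calc _ ≤ (Finset.range (2 ^ k)).card := Finset.card_le_card fun p hp => by
        simpa using (Finset.mem_filter.mp hp).2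
    _ = _ := Finset.card_range _

/-- The representations `N = x² + 3y²`, as a finite set. -/
def formReps (N : ℕ) : Finset (ℤ × ℤ) :=
  (Finset.Icc (-(N : ℤ)) N ×ˢ Finset.Icc (-(N : ℤ)) N).filter fun v =>
    v.1 ^ 2 + 3 * v.2 ^ 2 = N

theorem mem_formReps {N : ℕ} {v : ℤ × ℤ} :
    v ∈ formReps N ↔ v.1 ^ 2 + 3 * v.2 ^ 2 = N := by
  simp only [formReps, Finset.mem_filter, Finset.mem_product, Finset.mem_Icc, and_iff_right_iff_imp]
  intro h
  have h1 : |v.1| ≤ v.1 ^ 2 := by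
    rw [← sq_abs]; exact Int.le_self_sq _
  have h2 : |v.2| ≤ v.2 ^ 2 := by
    rw [← sq_abs]; exact Int.le_self_sq _
  rw [← abs_le, ← abs_le]
  constructor <;> nlinarith [sq_nonneg v.1, sq_nonneg v.2]

theorem isCoprime_snd_of_rep {N x y : ℤ} (h : x ^ 2 + 3 * y ^ 2 = N) (hxy : IsCoprime x y) :
    IsCoprime y N := by
  have h1 : IsCoprime y (x ^ 2) := (hxy.symm).pow_right
  rw [← h, show x ^ 2 + 3 * y ^ 2 = x ^ 2 + y * (3 * y) by ring]
  exact h1.add_mul_left_right _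

/-- Two primitive representations of `N` having the same gcd of `N` with the cross product against
a fixed primitive representation have cross product divisible by `N / 2`. -/
theorem dvd_two_mul_cross {N : ℕ} (hN : N ≠ 0) {x₀ y₀ x y x' y' : ℤ}
    (h₀ : x₀ ^ 2 + 3 * y₀ ^ 2 = N) (hc₀ : IsCoprime x₀ y₀)
    (h : x ^ 2 + 3 * y ^ 2 = N) (hc : IsCoprime x y)
    (h' : x' ^ 2 + 3 * y' ^ 2 = N)
    (hg : Int.gcd N (x * y₀ - x₀ * y) = Int.gcd N (x' * y₀ - x₀ * y')) :
    (N : ℤ) ∣ 2 * (x * y' - x' * y) := by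
  have hNZ : (N : ℤ) ≠ 0 := by exact_mod_cast hN
  set g : ℤ := (Int.gcd N (x * y₀ - x₀ * y) : ℤ) with hgdef
  have hg' : g = (Int.gcd N (x' * y₀ - x₀ * y') : ℤ) := by rw [hgdef, hg]
  have hgN : g ∣ N := Int.gcd_dvd_left ..
  obtain ⟨e, he⟩ := hgN
  have hg0 : g ≠ 0 := by rintro h0; rw [h0, zero_mul] at he; exact hNZ he
  have hy₀ : IsCoprime y₀ (N : ℤ) := isCoprime_snd_of_rep h₀ hc₀
  have hy : IsCoprime y (N : ℤ) := isCoprime_snd_of_rep h hc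
  have hgA : g ∣ x * y₀ - x₀ * y := Int.gcd_dvd_right ..
  have hgA' : g ∣ x' * y₀ - x₀ * y' := by rw [hg']; exact Int.gcd_dvd_right ..
  have heB : ∀ u v : ℤ, u ^ 2 + 3 * v ^ 2 = N → g = (Int.gcd N (u * y₀ - x₀ * v) : ℤ) →
      e ∣ u * y₀ + x₀ * v := by
    intro u v huv hguv
    have h1 : (N : ℤ) ∣ (u * y₀ - x₀ * v) * (u * y₀ + x₀ * v) :=
      ⟨y₀ ^ 2 - v ^ 2, by linear_combination y₀ ^ 2 * huv - v ^ 2 * h₀⟩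
    have h2 := dvd_gcd_mul_of_dvd_mul h1
    rw [← Int.coe_gcd, ← hguv, he] at h2
    exact (mul_dvd_mul_iff_left hg0).mp h2
  have hB := heB x y h rfl
  have hB' := heB x' y' h' hg'
  have hyg : IsCoprime g y₀ := (hy₀.of_isCoprime_of_dvd_right ⟨e, he⟩).symm
  have hye : IsCoprime e y₀ := (hy₀.of_isCoprime_of_dvd_right ⟨g, by rw [he, mul_comm]⟩).symm
  have hgQ : g ∣ x * y' - x' * y := by
    refine hyg.dvd_of_dvd_mul_left ?_
    have : y₀ * (x * y' - x' * y) = (x * y₀ - x₀ * y) * y' - (x' * y₀ - x₀ * y') * y := by ring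
    rw [this]
    exact dvd_sub (hgA.mul_right _) (hgA'.mul_right _)
  have heQ : e ∣ x * y' - x' * y := by
    refine hye.dvd_of_dvd_mul_left ?_
    have : y₀ * (x * y' - x' * y) = (x * y₀ + x₀ * y) * y' - (x' * y₀ + x₀ * y') * y := by ring
    rw [this]
    exact dvd_sub (hB.mul_right _) (hB'.mul_right _)
  have hh1 : ((Int.gcd g e : ℕ) : ℤ) ∣ g := Int.gcd_dvd_left ..
  have hh2 : ((Int.gcd g e : ℕ) : ℤ) ∣ e := Int.gcd_dvd_right ..
  have hpos : 0 < Int.gcd g e := Int.gcd_pos_of_ne_zero_left _ hg0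
  have hlcm := Int.gcd_mul_lcm g e
  set k : ℕ := Int.gcd g e with hk
  have hsq : (k : ℤ) ^ 2 ∣ N := by rw [sq, he]; exact mul_dvd_mul hh1 hh2
  have hkN : (k : ℤ) ∣ N := (Dvd.intro_left _ (sq _).symm).trans hsq
  have hyk : IsCoprime (k : ℤ) y₀ := (hy₀.of_isCoprime_of_dvd_right hkN).symm
  have hk2x : (k : ℤ) ∣ 2 * x := by
    refine hyk.dvd_of_dvd_mul_left ?_
    have : y₀ * (2 * x) = (x * y₀ - x₀ * y) + (x * y₀ + x₀ * y) := by ring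
    rw [this]
    exact dvd_add (hh1.trans hgA) (hh2.trans hB)
  have hk12 : (k : ℤ) ^ 2 ∣ 12 := by
    have h1 : (k : ℤ) ^ 2 ∣ y ^ 2 * 12 := by
      have : y ^ 2 * 12 = N * 4 - (2 * x) ^ 2 := by linear_combination 4 * h
      rw [this]
      exact dvd_sub (hsq.mul_right _) (pow_dvd_pow_of_dvd hk2x 2)
    have h2 : IsCoprime ((k : ℤ) ^ 2) (y ^ 2) :=
      (hy.of_isCoprime_of_dvd_right hkN).symm.pow
    exact h2.dvd_of_dvd_mul_left h1
  have hk2 : (k : ℤ) ∣ 2 := by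
    have hk12' : k ^ 2 ∣ 12 := by exact_mod_cast hk12
    have hle : k ^ 2 ≤ 12 := Nat.le_of_dvd (by norm_num) hk12'
    have hk3 : k ≤ 3 := by nlinarith
    clear_value k
    interval_cases k
    · norm_num
    · norm_num
    · norm_num at hk12'
  have hl : ((Int.lcm g e : ℕ) : ℤ) ∣ x * y' - x' * y := Int.coe_lcm_dvd hgQ heQ
  have hN' : (N : ℤ) ∣ k * (Int.lcm g e : ℕ) := by
    have : ((k * Int.lcm g e : ℕ) : ℤ) = |g * e| := by
      rw [hlcm]; simp
    rw [← Nat.cast_mul, this, ← he]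
    exact (dvd_abs _ _).mpr dvd_rfl
  exact hN'.trans (mul_dvd_mul hk2 hl)

theorem cross_mem_units {N : ℤ} (hN : 0 < N) {P Q : ℤ} (h : P ^ 2 + 3 * Q ^ 2 = N ^ 2)
    (hd : N ∣ 2 * Q) :
    (2 * P, 2 * Q) ∈ ({(2 * N, 0), (-(2 * N), 0), (N, N), (-N, N), (N, -N), (-N, -N)} :
      Finset (ℤ × ℤ)) := by
  obtain ⟨k, hk⟩ := hd
  have h4 : (2 * P) ^ 2 = N ^ 2 * (4 - 3 * k ^ 2) := by
    have : (2 * Q) ^ 2 = (N * k) ^ 2 := by rw [hk]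
    linear_combination 4 * h - 3 * this
  have hk1 : k ^ 2 ≤ 1 := by
    by_contra hcon
    push Not at hcon
    nlinarith [sq_nonneg (2 * P), mul_pos hN hN]
  have hka : -1 ≤ k := by nlinarith
  have hkb : k ≤ 1 := by nlinarith
  rw [hk]
  have hs : ∀ s : ℤ, (2 * P) ^ 2 = s ^ 2 → 2 * P = s ∨ 2 * P = -s := fun s h =>
    sq_eq_sq_iff_eq_or_eq_neg.mp h
  interval_cases k
  · rcases hs N (by rw [h4]; ring) with h | h <;> simp [h]
  · rcases hs (2 * N) (by rw [h4]; ring) with h | h <;> simp [h]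
  · rcases hs N (by rw [h4]; ring) with h | h <;> simp [h]

theorem card_primitive_formReps_le {N : ℕ} (hN : N ≠ 0) :
    ((formReps N).filter fun v => IsCoprime v.1 v.2).card ≤ 6 * N.divisors.card := by
  classical
  set R := (formReps N).filter fun v => IsCoprime v.1 v.2 with hR
  have hmem : ∀ v, v ∈ R ↔ v.1 ^ 2 + 3 * v.2 ^ 2 = (N : ℤ) ∧ IsCoprime v.1 v.2 := fun v => by
    rw [hR, Finset.mem_filter, mem_formReps]
  rcases R.eq_empty_or_nonempty with h | ⟨v₀, hv₀⟩
  · simp [h]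
  have hv₀' := (hmem v₀).mp hv₀
  let φ : ℤ × ℤ → ℕ := fun v => Int.gcd N (v.1 * v₀.2 - v₀.1 * v.2)
  have himg : R.image φ ⊆ N.divisors := by
    intro g hg
    obtain ⟨v, -, rfl⟩ := Finset.mem_image.mp hg
    rw [Nat.mem_divisors]
    exact ⟨by exact_mod_cast (Int.gcd_dvd_left (N : ℤ) _), hN⟩
  refine (Finset.card_le_mul_card_image (f := φ) R 6 ?_).trans
    (Nat.mul_le_mul_left _ (Finset.card_le_card himg))
  intro g hg
  obtain ⟨v₁, hv₁, rfl⟩ := Finset.mem_image.mp hg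
  have hv₁' := (hmem v₁).mp hv₁
  have hNZ : (N : ℤ) ≠ 0 := by exact_mod_cast hN
  let T : Finset (ℤ × ℤ) := {(2 * (N : ℤ), 0), (-(2 * (N : ℤ)), 0), ((N : ℤ), (N : ℤ)),
    (-(N : ℤ), (N : ℤ)), ((N : ℤ), -(N : ℤ)), (-(N : ℤ), -(N : ℤ))}
  have hT : T.card ≤ 6 := Finset.card_le_six
  refine le_trans (Finset.card_le_card_of_injOn (t := T)
    (fun v => (2 * (v.1 * v₁.1 + 3 * v.2 * v₁.2), 2 * (v.1 * v₁.2 - v₁.1 * v.2))) ?_ ?_) hT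
  · intro v hv
    obtain ⟨hv1, hv2⟩ := Finset.mem_filter.mp (Finset.mem_coe.mp hv)
    have hv' := (hmem v).mp hv1
    refine cross_mem_units (by positivity) ?_ ?_
    · linear_combination (v₁.1 ^ 2 + 3 * v₁.2 ^ 2) * hv'.1 + (N : ℤ) * hv₁'.1
    · exact dvd_two_mul_cross hN hv₀'.1 hv₀'.2 hv'.1 hv'.2 hv₁'.1 hv2
  · intro v hv w hw hvw
    simp only [Prod.mk.injEq] at hvw
    obtain ⟨e1, e2⟩ := hvw
    have f1 : 2 * N * v.1 = 2 * N * w.1 := by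
      linear_combination v₁.1 * e1 + 3 * v₁.2 * e2 - 2 * (v.1 - w.1) * hv₁'.1
    have f2 : 2 * N * v.2 = 2 * N * w.2 := by
      linear_combination v₁.2 * e1 - v₁.1 * e2 - 2 * (v.2 - w.2) * hv₁'.1
    have h2 : (2 * N : ℤ) ≠ 0 := by positivity
    exact Prod.ext (mul_left_cancel₀ h2 f1) (mul_left_cancel₀ h2 f2)

theorem card_formReps_le {N : ℕ} (hN : N ≠ 0) :
    (formReps N).card ≤ 6 * N.divisors.card ^ 2 := by
  classical
  let φ : ℤ × ℤ → ℕ := fun v => Int.gcd v.1 v.2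
  have hφ : ∀ v ∈ formReps N, φ v ^ 2 ∣ N ∧ φ v ∣ N := by
    intro v hv
    rw [mem_formReps] at hv
    have h1 : ((φ v : ℕ) : ℤ) ∣ v.1 := Int.gcd_dvd_left ..
    have h2 : ((φ v : ℕ) : ℤ) ∣ v.2 := Int.gcd_dvd_right ..
    have h3 : ((φ v : ℕ) : ℤ) ^ 2 ∣ N := by
      rw [← hv]
      exact dvd_add (pow_dvd_pow_of_dvd h1 2) ((pow_dvd_pow_of_dvd h2 2).mul_left _)
    have h4 : φ v ^ 2 ∣ N := by exact_mod_cast h3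
    exact ⟨h4, (Dvd.intro_left _ (sq _).symm).trans h4⟩
  have himg : (formReps N).image φ ⊆ N.divisors := by
    intro g hg
    obtain ⟨v, hv, rfl⟩ := Finset.mem_image.mp hg
    exact Nat.mem_divisors.mpr ⟨(hφ v hv).2, hN⟩
  have := (Finset.card_le_mul_card_image (f := φ) (formReps N) (6 * N.divisors.card) ?_).trans
    (Nat.mul_le_mul_left _ (Finset.card_le_card himg))
  · rw [sq, ← mul_assoc]; exact this
  intro g hg
  obtain ⟨v₁, hv₁, rfl⟩ := Finset.mem_image.mp hg
  obtain ⟨M, hM⟩ := (hφ v₁ hv₁).1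
  set g := φ v₁ with hgdef
  have hg0 : g ≠ 0 := by rintro h; rw [h] at hM; simp at hM; exact hN hM
  have hM0 : M ≠ 0 := by rintro rfl; simp at hM; exact hN hM
  have hMN : M.divisors.card ≤ N.divisors.card :=
    Finset.card_le_card (Nat.divisors_subset_of_dvd hN ⟨g ^ 2, by rw [hM, mul_comm]⟩)
  refine le_trans ?_ ((card_primitive_formReps_le hM0).trans (Nat.mul_le_mul_left _ hMN))
  have hgZ : (g : ℤ) ≠ 0 := by exact_mod_cast hg0
  have hdv : ∀ v : ℤ × ℤ, φ v = g → v.1 = g * (v.1 / g) ∧ v.2 = g * (v.2 / g) := by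
    intro v hv
    rw [← hv]
    exact ⟨(Int.mul_ediv_cancel' (Int.gcd_dvd_left ..)).symm,
      (Int.mul_ediv_cancel' (Int.gcd_dvd_right ..)).symm⟩
  refine Finset.card_le_card_of_injOn (fun v => (v.1 / (g : ℤ), v.2 / (g : ℤ))) ?_ ?_
  · intro v hv
    obtain ⟨hv1, hv2⟩ := Finset.mem_filter.mp (Finset.mem_coe.mp hv)
    rw [mem_formReps] at hv1
    obtain ⟨e1, e2⟩ := hdv v hv2
    rw [Finset.mem_coe, Finset.mem_filter, mem_formReps]
    constructor
    · have : (g : ℤ) ^ 2 * ((v.1 / g) ^ 2 + 3 * (v.2 / g) ^ 2) = (g : ℤ) ^ 2 * M := by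
        have hM' : (N : ℤ) = (g : ℤ) ^ 2 * M := by exact_mod_cast hM
        rw [← hM', ← hv1]
        calc _ = (g * (v.1 / g)) ^ 2 + 3 * (g * (v.2 / g)) ^ 2 := by ring
          _ = _ := by rw [← e1, ← e2]
      exact mul_left_cancel₀ (pow_ne_zero 2 hgZ) this
    · rw [Int.isCoprime_iff_gcd_eq_one]
      have hpos : 0 < Int.gcd v.1 v.2 := by
        have : Int.gcd v.1 v.2 = g := hv2
        omega
      have := Int.gcd_div_gcd_div_gcd hpos
      rw [show Int.gcd v.1 v.2 = g from hv2] at this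
      exact this
  · intro v hv w hw hvw
    obtain ⟨-, hv2⟩ := Finset.mem_filter.mp (Finset.mem_coe.mp hv)
    obtain ⟨-, hw2⟩ := Finset.mem_filter.mp (Finset.mem_coe.mp hw)
    simp only [Prod.mk.injEq] at hvw
    obtain ⟨e1, e2⟩ := hdv v hv2
    obtain ⟨e3, e4⟩ := hdv w hw2
    exact Prod.ext (by rw [e1, e3, hvw.1]) (by rw [e2, e4, hvw.2])

theorem exists_card_formReps_pow_le :
    ∃ C : ℕ, ∀ N : ℕ, (formReps N).card ^ 6 ≤ C * N + 1 := by
  obtain ⟨C, hC⟩ := exists_card_divisors_pow_le 12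
  refine ⟨6 ^ 6 * C, fun N => ?_⟩
  rcases eq_or_ne N 0 with rfl | hN
  · have h : (formReps 0).card ≤ 1 := (Finset.card_filter_le _ _).trans (by simp)
    simpa using Nat.pow_le_pow_left h 6
  calc (formReps N).card ^ 6 ≤ (6 * N.divisors.card ^ 2) ^ 6 :=
        Nat.pow_le_pow_left (card_formReps_le hN) _
    _ = 6 ^ 6 * N.divisors.card ^ 12 := by ring
    _ ≤ 6 ^ 6 * (C * N) := Nat.mul_le_mul_left _ (hC N hN)
    _ = 6 ^ 6 * C * N := by ring
    _ ≤ _ := Nat.le_succ _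

theorem natDegree_cubicPoly {n : ℤ} (hn : n ≠ 0) (b c d : ℤ) :
    (cubicPoly n b c d).natDegree = 3 :=
  Polynomial.natDegree_cubic (by exact_mod_cast hn)

theorem irreducible_cubicPoly {n b c d : ℤ} (hn : n ≠ 0)
    (hroot : ∀ t : ℤ, t ^ 3 + b * t ^ 2 + c * n * t + d * n ^ 2 ≠ 0) :
    Irreducible (cubicPoly n b c d) := by
  have hdeg := natDegree_cubicPoly hn b c d
  refine irreducible_of_degree_le_three_of_not_isRoot (by rw [hdeg]; decide) fun x hx => ?_
  have hx' : (n : ℚ) * x ^ 3 + b * x ^ 2 + c * x + d = 0 := by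
    simpa [cubicPoly, IsRoot] using hx
  let q : ℤ[X] := C 1 * X ^ 3 + C b * X ^ 2 + C (c * n) * X + C (d * n ^ 2)
  have hq : q.Monic := Polynomial.leadingCoeff_cubic one_ne_zero
  have hev : aeval ((n : ℚ) * x) q = 0 := by
    simp only [q, map_add, map_mul, map_pow, aeval_X, aeval_C]
    simp only [eq_intCast, Int.cast_one]
    linear_combination (n : ℚ) ^ 2 * hx'
  obtain ⟨t, ht⟩ := isInteger_of_is_root_of_monic hq hev
  rw [eq_intCast] at ht
  apply hroot t
  have : (t : ℚ) ^ 3 + b * t ^ 2 + c * n * t + d * n ^ 2 = 0 := by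
    rw [ht]
    linear_combination (n : ℚ) ^ 2 * hx'
  exact_mod_cast this

theorem finrank_splittingField_cubicPoly {n b c d : ℤ} (hn : n ≠ 0)
    (hirr : Irreducible (cubicPoly n b c d)) (hdisc : ¬ IsSquare (discForm n b c d)) :
    Module.finrank ℚ (cubicPoly n b c d).SplittingField = 6 := by
  have hdeg := natDegree_cubicPoly hn b c d
  set p := cubicPoly n b c d with hp
  have hcard : Nat.card p.Gal = Module.finrank ℚ p.SplittingField :=
    Polynomial.Gal.card_of_separable hirr.separable
  have h3 : 3 ∣ Nat.card p.Gal := by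
    have := Polynomial.Gal.prime_degree_dvd_card hirr (by rw [hdeg]; norm_num)
    rwa [hdeg] at this
  have hsplit : (p.map (algebraMap ℚ p.SplittingField)).Splits := SplittingField.splits p
  have hle : Nat.card p.Gal ≤ 6 := by
    have : Fact ((p.map (algebraMap ℚ p.SplittingField)).Splits) := ⟨hsplit⟩
    have h1 := Nat.card_le_card_of_injective _ (Gal.galActionHom_injective p p.SplittingField)
    rw [Nat.card_perm, Nat.card_eq_fintype_card (α := p.rootSet p.SplittingField),
      card_rootSet_eq_natDegree hirr.separable hsplit, hdeg] at h1
    exact h1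
  have h2 : 2 ∣ Module.finrank ℚ p.SplittingField := by
    let P : Cubic ℚ := ⟨n, b, c, d⟩
    have hPp : P.toPoly = p := rfl
    have ha : P.a ≠ 0 := by
      change (n : ℚ) ≠ 0
      exact_mod_cast hn
    obtain ⟨x, y, z, h⟩ := (Cubic.splits_iff_roots_eq_three
      (φ := algebraMap ℚ p.SplittingField) ha).mp (by rw [hPp]; exact hsplit)
    have hdis := Cubic.discr_eq_prod_three_roots ha h
    have hPd : P.discr = (discForm n b c d : ℚ) := by
      simp only [P, Cubic.discr, discForm]
      push_cast
      ring
    rw [hPd] at hdis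
    set δ := algebraMap ℚ p.SplittingField P.a * algebraMap ℚ p.SplittingField P.a *
      (x - y) * (x - z) * (y - z) with hδ
    have hirr2 : Irreducible (X ^ 2 - C (discForm n b c d : ℚ)) := by
      refine X_pow_sub_C_irreducible_of_prime Nat.prime_two fun r hr => hdisc ?_
      rw [← Rat.isSquare_intCast_iff]
      exact ⟨r, by rw [← hr, sq]⟩
    have hmin : X ^ 2 - C (discForm n b c d : ℚ) = minpoly ℚ δ := by
      refine minpoly.eq_of_irreducible_of_monic hirr2 ?_ (monic_X_pow_sub_C _ two_ne_zero)
      rw [map_sub, map_pow, aeval_X, aeval_C, hdis, sub_self]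
    have := minpoly.degree_dvd (K := ℚ) (IsIntegral.of_finite ℚ δ)
    rwa [← hmin, natDegree_X_pow_sub_C] at this
  have hpos : 0 < Module.finrank ℚ p.SplittingField := Module.finrank_pos
  omega

theorem genericForm_of_not_root_of_not_isSquare {n b c d : ℤ} (hn : n ≠ 0)
    (hroot : ∀ t : ℤ, t ^ 3 + b * t ^ 2 + c * n * t + d * n ^ 2 ≠ 0)
    (hdisc : ¬ IsSquare (discForm n b c d)) : GenericForm n b c d :=
  have h := irreducible_cubicPoly hn hroot
  ⟨h, finrank_splittingField_cubicPoly hn h hdisc⟩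

theorem card_Icc_neg_floor_le {y : ℝ} (hy : 1 ≤ y) :
    ((Finset.Icc (-⌊y⌋) ⌊y⌋).card : ℝ) ≤ 3 * y := by
  have h0 : 0 ≤ ⌊y⌋ := Int.floor_nonneg.mpr (by linarith)
  have h1 : ((Finset.Icc (-⌊y⌋) ⌊y⌋).card : ℤ) = 2 * ⌊y⌋ + 1 := by
    rw [Int.card_Icc, Int.toNat_of_nonneg (by omega)]
    ring
  have h2 : ((Finset.Icc (-⌊y⌋) ⌊y⌋).card : ℝ) = 2 * ⌊y⌋ + 1 := by exact_mod_cast h1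
  rw [h2]
  linarith [Int.floor_le y]

theorem mem_Icc_neg_floor {y : ℝ} {k : ℤ} (h : |(k : ℝ)| ≤ y) :
    k ∈ Finset.Icc (-⌊y⌋) ⌊y⌋ := by
  rw [abs_le] at h
  rw [Finset.mem_Icc]
  refine ⟨?_, Int.le_floor.mpr h.2⟩
  have : -k ≤ ⌊y⌋ := Int.le_floor.mpr (by push_cast; linarith)
  linarith

theorem abs_le_of_cubic_bound {t A Z : ℝ} (hA : 1 ≤ A) (hZ : 0 < Z)
    (h : |t| ^ 3 ≤ A * Z * t ^ 2 + A * Z ^ 2 * |t| + A * Z ^ 3) : |t| ≤ 3 * A * Z := by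
  by_contra! hcon
  rw [← sq_abs t] at h
  set u := |t|
  have h1 : Z ≤ A * Z := by nlinarith
  have hu : 3 * Z < u := by nlinarith
  have hu0 : 0 < u := by linarith
  have e1 : 3 * (A * Z * u ^ 2) < u ^ 3 := by nlinarith [mul_pos hu0 hu0]
  have e2 : 9 * (A * Z ^ 2 * u) ≤ u ^ 3 := by
    have : 9 * (A * Z * Z) ≤ u * u := by nlinarith
    nlinarith
  have e3 : 27 * (A * Z ^ 3) ≤ u ^ 3 := by
    have : 9 * (A * Z * Z) ≤ u * u := by nlinarith
    nlinarith [mul_pos hu0 hu0]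
  have hp : 0 < u ^ 3 := by positivity
  linarith

/-- There are few pairs `(c, d)` for which the cubic form has a rational root. -/
theorem card_le_of_root {n : ℤ} (hn : n ≠ 0) (b : ℤ) {A : ℝ} (hA : 1 ≤ A) :
    ∃ K : ℝ, ∀ Z : ℝ, 1 ≤ Z → ∀ T : Finset (ℤ × ℤ),
      (∀ v ∈ T, |(v.1 : ℝ)| ≤ A * Z ^ 2 ∧ |(v.2 : ℝ)| ≤ A * Z ^ 3) →
      (∀ v ∈ T, ∃ t : ℤ, t ^ 3 + b * t ^ 2 + v.1 * n * t + v.2 * n ^ 2 = 0) →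
      (T.card : ℝ) ≤ K * Z ^ 3 := by
  classical
  obtain ⟨B, hB1, hBb, hBc, hBd⟩ : ∃ B : ℝ, 1 ≤ B ∧ |(b : ℝ)| ≤ B ∧ A * |(n : ℝ)| ≤ B ∧
      A * (n : ℝ) ^ 2 ≤ B := by
    refine ⟨1 + |(b : ℝ)| + A * |(n : ℝ)| + A * (n : ℝ) ^ 2, ?_, ?_, ?_, ?_⟩ <;>
    linarith [abs_nonneg (b : ℝ), mul_nonneg (by linarith : (0 : ℝ) ≤ A) (abs_nonneg (n : ℝ)),
      mul_nonneg (by linarith : (0 : ℝ) ≤ A) (sq_nonneg (n : ℝ))]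
  refine ⟨27 * (A * B), fun Z hZ T hT hroot => ?_⟩
  have hZ0 : 0 < Z := by linarith
  let S₁ := Finset.Icc (-⌊3 * B * Z⌋) ⌊3 * B * Z⌋
  let S₂ := Finset.Icc (-⌊A * Z ^ 2⌋) ⌊A * Z ^ 2⌋
  have hsub : T ⊆ (S₁ ×ˢ S₂).image fun w =>
      (w.2, -(w.1 ^ 3 + b * w.1 ^ 2 + w.2 * n * w.1) / n ^ 2) := by
    intro v hv
    obtain ⟨t, ht⟩ := hroot v hv
    obtain ⟨hc, hd⟩ := hT v hv
    refine Finset.mem_image.mpr ⟨(t, v.1), Finset.mem_product.mpr ⟨mem_Icc_neg_floor ?_,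
      mem_Icc_neg_floor hc⟩, Prod.ext rfl ?_⟩
    · refine abs_le_of_cubic_bound hB1 hZ0 ?_
      have ht' : (t : ℝ) ^ 3 = -(b * t ^ 2) - v.1 * n * t - v.2 * n ^ 2 := by
        have : (t : ℝ) ^ 3 + b * t ^ 2 + v.1 * n * t + v.2 * n ^ 2 = 0 := by exact_mod_cast ht
        linarith
      rw [← abs_pow, ht']
      calc |-((b : ℝ) * t ^ 2) - v.1 * n * t - v.2 * n ^ 2|
          ≤ |(b : ℝ) * t ^ 2| + |(v.1 : ℝ) * n * t| + |(v.2 : ℝ) * n ^ 2| := by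
            refine (abs_sub _ _).trans ?_
            refine add_le_add ((abs_sub _ _).trans ?_) le_rfl
            rw [abs_neg]
        _ = |(b : ℝ)| * t ^ 2 + |(v.1 : ℝ)| * |(n : ℝ)| * |(t : ℝ)| +
            |(v.2 : ℝ)| * n ^ 2 := by
            simp only [abs_mul, abs_pow, sq_abs]
        _ ≤ B * t ^ 2 + (A * Z ^ 2) * |(n : ℝ)| * |(t : ℝ)| + (A * Z ^ 3) * n ^ 2 := by gcongr
        _ = B * t ^ 2 + (A * |(n : ℝ)|) * Z ^ 2 * |(t : ℝ)| + (A * n ^ 2) * Z ^ 3 := by ring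
        _ ≤ B * t ^ 2 + B * Z ^ 2 * |(t : ℝ)| + B * Z ^ 3 := by gcongr
        _ ≤ B * Z * t ^ 2 + B * Z ^ 2 * |(t : ℝ)| + B * Z ^ 3 := by
            gcongr
            nlinarith
    · refine Int.ediv_eq_of_eq_mul_left (pow_ne_zero 2 hn) ?_
      simp only
      linear_combination -ht
  have h1 := (Finset.card_le_card hsub).trans Finset.card_image_le
  rw [Finset.card_product] at h1
  have h2 : (T.card : ℝ) ≤ (S₁.card : ℝ) * S₂.card := by exact_mod_cast h1
  have h3 : (S₁.card : ℝ) ≤ 3 * (3 * B * Z) := card_Icc_neg_floor_le (by nlinarith)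
  have h4 : (S₂.card : ℝ) ≤ 3 * (A * Z ^ 2) := card_Icc_neg_floor_le (by nlinarith)
  calc (T.card : ℝ) ≤ (3 * (3 * B * Z)) * (3 * (A * Z ^ 2)) :=
        h2.trans (mul_le_mul h3 h4 (by positivity) (by positivity))
    _ = 27 * (A * B) * Z ^ 3 := by ring

theorem twenty_seven_mul_discForm (n b c d : ℤ) :
    27 * n ^ 2 * discForm n b c d = 4 * Iform n b c ^ 3 - Jform n b c d ^ 2 := by
  simp only [discForm, Iform, Jform]
  ring

/-- For fixed `c`, few `d` give a square discriminant. -/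
theorem exists_card_le_formReps {n : ℤ} (hn : n ≠ 0) (b c : ℤ) (T : Finset ℤ)
    (hT : ∀ d ∈ T, IsSquare (discForm n b c d)) :
    T.card ≤ (formReps (4 * Iform n b c ^ 3).toNat).card := by
  classical
  choose! e he using hT
  refine Finset.card_le_card_of_injOn (fun d => (Jform n b c d, 3 * n * e d)) ?_ ?_
  · intro d hd
    have h := he d hd
    have h1 := twenty_seven_mul_discForm n b c d
    rw [h] at h1
    have h2 : 4 * Iform n b c ^ 3 = Jform n b c d ^ 2 + 3 * (3 * n * e d) ^ 2 := by
      linear_combination -h1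
    rw [Finset.mem_coe, mem_formReps, h2, Int.toNat_of_nonneg (by positivity)]
  · intro d _ d' _ h
    have h1 : Jform n b c d = Jform n b c d' := congrArg Prod.fst h
    simp only [Jform] at h1
    have h2 : 27 * n ^ 2 * d = 27 * n ^ 2 * d' := by linarith
    exact mul_left_cancel₀ (by positivity) h2

/-- There are few pairs `(c, d)` for which the discriminant is a square. -/
theorem card_le_of_isSquare {n : ℤ} (hn : n ≠ 0) (b : ℤ) {A : ℝ} (hA : 1 ≤ A) :
    ∃ K : ℝ, ∀ Z : ℝ, 1 ≤ Z → ∀ T : Finset (ℤ × ℤ),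
      (∀ v ∈ T, |(v.1 : ℝ)| ≤ A * Z ^ 2) →
      (∀ v ∈ T, IsSquare (discForm n b v.1 v.2)) →
      (T.card : ℝ) ≤ K * Z ^ 3 := by
  classical
  obtain ⟨C, hC⟩ := exists_card_formReps_pow_le
  set B : ℝ := (b : ℝ) ^ 2 + 3 * |(n : ℝ)| * A with hB
  have hB0 : 0 ≤ B := by positivity
  set D : ℝ := C * (4 * B ^ 3) + 1 with hD
  have hD1 : 1 ≤ D := by
    have : 0 ≤ (C : ℝ) * (4 * B ^ 3) := by positivity
    linarith
  refine ⟨3 * A * D, fun Z hZ T hT hsq => ?_⟩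
  have hZ0 : 0 < Z := by linarith
  let S₂ := Finset.Icc (-⌊A * Z ^ 2⌋) ⌊A * Z ^ 2⌋
  have h4 : (S₂.card : ℝ) ≤ 3 * (A * Z ^ 2) := card_Icc_neg_floor_le (by nlinarith)
  have hfib : ∀ c ∈ S₂, ((T.filter fun v => v.1 = c).card : ℝ) ≤ D * Z := by
    intro c _
    rcases (T.filter fun v => v.1 = c).eq_empty_or_nonempty with h | ⟨v₀, hv₀⟩
    · rw [h]; simp only [Finset.card_empty, Nat.cast_zero]; positivity
    obtain ⟨hv₀T, rfl⟩ := Finset.mem_filter.mp hv₀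
    have hc := hT v₀ hv₀T
    set c := v₀.1
    have h1 : (T.filter fun v => v.1 = c).card ≤
        (formReps (4 * Iform n b c ^ 3).toNat).card := by
      rw [← Finset.card_image_of_injOn (f := Prod.snd)]
      · refine exists_card_le_formReps hn b c _ fun d hd => ?_
        obtain ⟨v, hv, rfl⟩ := Finset.mem_image.mp hd
        obtain ⟨hvT, hvc⟩ := Finset.mem_filter.mp hv
        rw [← hvc]
        exact hsq v hvT
      · intro v hv w hw hvw
        exact Prod.ext ((Finset.mem_filter.mp hv).2.trans (Finset.mem_filter.mp hw).2.symm) hvw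
    have hI : |(Iform n b c : ℝ)| ≤ B * Z ^ 2 := by
      simp only [Iform]
      push_cast
      calc |(b : ℝ) ^ 2 - 3 * n * c| ≤ |(b : ℝ) ^ 2| + |3 * (n : ℝ) * c| := abs_sub _ _
        _ = (b : ℝ) ^ 2 + 3 * |(n : ℝ)| * |(c : ℝ)| := by
            simp [abs_mul]
        _ ≤ (b : ℝ) ^ 2 * Z ^ 2 + 3 * |(n : ℝ)| * (A * Z ^ 2) := by
            gcongr
            exact le_mul_of_one_le_right (sq_nonneg _) (one_le_pow₀ hZ)
        _ = B * Z ^ 2 := by rw [hB]; ring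
    have hN : ((4 * Iform n b c ^ 3).toNat : ℝ) ≤ 4 * B ^ 3 * Z ^ 6 := by
      have h5 : ((4 * Iform n b c ^ 3).toNat : ℤ) ≤ 4 * |Iform n b c| ^ 3 := by
        rw [Int.toNat_eq_max]
        refine max_le ?_ (by positivity)
        rw [← abs_pow]
        linarith [le_abs_self (Iform n b c ^ 3)]
      have h6 : ((4 * Iform n b c ^ 3).toNat : ℝ) ≤ 4 * |(Iform n b c : ℝ)| ^ 3 := by
        exact_mod_cast h5
      calc _ ≤ 4 * |(Iform n b c : ℝ)| ^ 3 := h6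
        _ ≤ 4 * (B * Z ^ 2) ^ 3 := by gcongr
        _ = _ := by ring
    have h7 : ((formReps (4 * Iform n b c ^ 3).toNat).card : ℝ) ^ 6 ≤ (D * Z) ^ 6 := by
      have h8 : ((formReps (4 * Iform n b c ^ 3).toNat).card : ℝ) ^ 6 ≤
          C * (4 * Iform n b c ^ 3).toNat + 1 := by exact_mod_cast hC _
      calc _ ≤ C * ((4 * Iform n b c ^ 3).toNat : ℝ) + 1 := h8
        _ ≤ C * (4 * B ^ 3 * Z ^ 6) + 1 * Z ^ 6 := by
            gcongr
            rw [one_mul]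
            exact one_le_pow₀ hZ
        _ = D * Z ^ 6 := by rw [hD]; ring
        _ ≤ D ^ 6 * Z ^ 6 := by
            gcongr
            exact le_self_pow₀ hD1 (by norm_num)
        _ = _ := by ring
    exact (Nat.cast_le.mpr h1).trans (le_of_pow_le_pow_left₀ (by norm_num) (by positivity) h7)
  have hmaps : ∀ v ∈ T, v.1 ∈ S₂ := fun v hv => mem_Icc_neg_floor (hT v hv)
  rw [Finset.card_eq_sum_card_fiberwise hmaps]
  push_cast
  calc _ ≤ ∑ c ∈ S₂, D * Z := Finset.sum_le_sum hfib
    _ = S₂.card * (D * Z) := by rw [Finset.sum_const, nsmul_eq_mul]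
    _ ≤ (3 * (A * Z ^ 2)) * (D * Z) := by gcongr
    _ = _ := by ring

/-- The integers `l` with `α < a - q * l < β`. -/
def apWindow (q a α β : ℝ) : Finset ℤ :=
  Finset.Ioo ⌊(a - β) / q⌋ ⌈(a - α) / q⌉

theorem mem_apWindow {q : ℝ} (hq : 0 < q) {a α β : ℝ} {l : ℤ} :
    l ∈ apWindow q a α β ↔ α < a - q * l ∧ a - q * l < β := by
  rw [apWindow, Finset.mem_Ioo, Int.floor_lt, Int.lt_ceil, div_lt_iff₀ hq, lt_div_iff₀ hq]
  constructor <;> rintro ⟨h1, h2⟩ <;> constructor <;> linarith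

theorem abs_card_apWindow_sub_le {q : ℝ} (hq : 0 < q) (a : ℝ) {α β : ℝ} (h : α ≤ β) :
    |((apWindow q a α β).card : ℝ) - (β - α) / q| ≤ 1 := by
  set x := (a - β) / q with hx
  set y := (a - α) / q with hy
  have hxy : (β - α) / q = y - x := by rw [hx, hy]; ring
  have hle : 0 ≤ y - x := by rw [← hxy]; exact div_nonneg (by linarith) hq.le
  have hcard : ((apWindow q a α β).card : ℝ) = max ((⌈y⌉ : ℝ) - ⌊x⌋ - 1) 0 := by
    have : ((apWindow q a α β).card : ℤ) = max (⌈y⌉ - ⌊x⌋ - 1) 0 := by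
      rw [apWindow, Int.card_Ioo, Int.toNat_eq_max]
    exact_mod_cast this
  rw [hcard, hxy]
  have h1 := Int.floor_le x
  have h2 := Int.lt_floor_add_one x
  have h3 := Int.le_ceil y
  have h4 := Int.ceil_lt_add_one y
  rcases max_cases ((⌈y⌉ : ℝ) - ⌊x⌋ - 1) 0 with ⟨e, h5⟩ | ⟨e, h5⟩ <;> rw [e, abs_le] <;>
    constructor <;> linarith

theorem sub_mul_sqrt_pow_three_le {x y : ℝ} (h : x ≤ y) :
    (y - x) * √x ^ 3 ≤ 2 / 5 * √y ^ 5 - 2 / 5 * √x ^ 5 := by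
  have hv := Real.sqrt_nonneg y
  rcases le_total x 0 with hx | hx
  · rw [Real.sqrt_eq_zero'.mpr hx]
    have := pow_nonneg hv 5
    norm_num
  · have hu := Real.sqrt_nonneg x
    have hx' := Real.sq_sqrt hx
    have hy' := Real.sq_sqrt (hx.trans h)
    set u := √x
    set v := √y
    rw [← hx', ← hy']
    have : 0 ≤ (v - u) ^ 2 * (2 * v ^ 3 + 4 * v ^ 2 * u + 6 * v * u ^ 2 + 3 * u ^ 3) := by
      positivity
    nlinarith

theorem le_sub_mul_sqrt_pow_three {x y : ℝ} (h : x ≤ y) :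
    2 / 5 * √y ^ 5 - 2 / 5 * √x ^ 5 ≤ (y - x) * √y ^ 3 := by
  have hv := Real.sqrt_nonneg y
  rcases le_total y 0 with hy | hy
  · rw [Real.sqrt_eq_zero'.mpr hy, Real.sqrt_eq_zero'.mpr (h.trans hy)]
    norm_num
  have hy' := Real.sq_sqrt hy
  rcases le_total x 0 with hx | hx
  · rw [Real.sqrt_eq_zero'.mpr hx]
    have h1 : y * √y ^ 3 ≤ (y - x) * √y ^ 3 :=
      mul_le_mul_of_nonneg_right (by linarith) (by positivity)
    have h2 : y * √y ^ 3 = √y ^ 5 := by nth_rewrite 1 [← hy']; ring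
    have := pow_nonneg hv 5
    norm_num
    linarith
  · have hu := Real.sqrt_nonneg x
    have hx' := Real.sq_sqrt hx
    set u := √x
    set v := √y
    rw [← hx', ← hy']
    have : 0 ≤ (v - u) ^ 2 * (2 * u ^ 3 + 4 * u ^ 2 * v + 6 * u * v ^ 2 + 3 * v ^ 3) := by
      positivity
    nlinarith

theorem abs_sum_range_sqrt_sub_le {q r M : ℝ} (hq : 0 < q) (hr : r ≤ q) (hM : 0 ≤ M) :
    |q * ∑ j ∈ Finset.range ⌈(M - r) / q⌉₊, √(r + q * j) ^ 3 - 2 / 5 * √M ^ 5| ≤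
      q * √(M + q) ^ 3 := by
  set N := ⌈(M - r) / q⌉₊ with hN
  let F : ℝ → ℝ := fun x => 2 / 5 * √x ^ 5
  have hFmono : ∀ {x y : ℝ}, x ≤ y → F x ≤ F y := fun {x y} h => by
    have := Real.sqrt_le_sqrt h
    simp only [F]
    gcongr
  have hup : q * ∑ j ∈ Finset.range N, √(r + q * j) ^ 3 ≤ F (r + q * N) := by
    have h1 : ∑ j ∈ Finset.range N, (F (r + q * (j + 1 : ℕ)) - F (r + q * j)) =
        F (r + q * N) - F (r + q * (0 : ℕ)) :=
      Finset.sum_range_sub (fun j : ℕ => F (r + q * j)) N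
    have h2 : 0 ≤ F (r + q * (0 : ℕ)) := by simp only [F]; positivity
    have h3 : q * ∑ j ∈ Finset.range N, √(r + q * j) ^ 3 ≤
        ∑ j ∈ Finset.range N, (F (r + q * (j + 1 : ℕ)) - F (r + q * j)) := by
      rw [Finset.mul_sum]
      refine Finset.sum_le_sum fun j _ => ?_
      have := sub_mul_sqrt_pow_three_le (x := r + q * j) (y := r + q * (j + 1 : ℕ))
        (by push_cast; nlinarith)
      rwa [show r + q * ((j + 1 : ℕ) : ℝ) - (r + q * j) = q by push_cast; ring] at this
    linarith
  have hlo : F (r + q * N - q) ≤ q * ∑ j ∈ Finset.range N, √(r + q * j) ^ 3 := by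
    have h1 : ∑ j ∈ Finset.range N, (F (r + q * (j + 1 : ℕ) - q) - F (r + q * j - q)) =
        F (r + q * N - q) - F (r + q * (0 : ℕ) - q) :=
      Finset.sum_range_sub (fun j : ℕ => F (r + q * j - q)) N
    have h2 : F (r + q * (0 : ℕ) - q) = 0 := by
      simp only [F]
      rw [Real.sqrt_eq_zero'.mpr (by push_cast; linarith)]
      norm_num
    have h3 : ∑ j ∈ Finset.range N, (F (r + q * (j + 1 : ℕ) - q) - F (r + q * j - q)) ≤
        q * ∑ j ∈ Finset.range N, √(r + q * j) ^ 3 := by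
      rw [Finset.mul_sum]
      refine Finset.sum_le_sum fun j _ => ?_
      have := le_sub_mul_sqrt_pow_three (x := r + q * j - q) (y := r + q * j) (by linarith)
      rw [show r + q * j - (r + q * j - q) = q by ring] at this
      rwa [show r + q * ((j + 1 : ℕ) : ℝ) - q = r + q * j by push_cast; ring]
    linarith
  have hN1 : M ≤ r + q * N := by
    have := Nat.le_ceil ((M - r) / q)
    rw [div_le_iff₀ hq] at this
    linarith
  have hN2 : r + q * N ≤ M + q := by
    rcases le_total r M with h | h
    · have := Nat.ceil_lt_add_one (div_nonneg (sub_nonneg.mpr h) hq.le)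
      rw [← hN, ← sub_lt_iff_lt_add, lt_div_iff₀ hq] at this
      linarith
    · have : N = 0 := Nat.ceil_eq_zero.mpr
        (div_nonpos_of_nonpos_of_nonneg (by linarith) hq.le)
      rw [this]
      push_cast
      linarith
  have e1 := hFmono hN2
  have e2 := hFmono (show M - q ≤ r + q * N - q by linarith)
  have e3 := le_sub_mul_sqrt_pow_three (x := M) (y := M + q) (by linarith)
  have e4 := le_sub_mul_sqrt_pow_three (x := M - q) (y := M) (by linarith)
  have e5 : √M ^ 3 ≤ √(M + q) ^ 3 := by
    have := Real.sqrt_le_sqrt (show M ≤ M + q by linarith)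
    gcongr
  have e6 : q * √M ^ 3 ≤ q * √(M + q) ^ 3 := mul_le_mul_of_nonneg_left e5 hq.le
  rw [show M + q - M = q by ring] at e3
  rw [show M - (M - q) = q by ring] at e4
  simp only [F] at e1 e2 hup hlo
  rw [abs_le]
  constructor <;> linarith

theorem abs_sum_apWindow_sqrt_sub_le {q M : ℝ} (hq : 0 < q) (hM : 0 ≤ M) (a : ℝ) :
    |∑ l ∈ apWindow q a 0 M, √(a - q * l) ^ 3 - 2 / 5 * √M ^ 5 / q| ≤ √(M + q) ^ 3 := by
  set k₁ : ℤ := ⌈a / q⌉ - 1 with hk₁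
  set r : ℝ := a - q * k₁ with hr
  have hr0 : 0 < r := by
    have := Int.ceil_lt_add_one (a / q)
    rw [← sub_lt_iff_lt_add, lt_div_iff₀ hq] at this
    rw [hr, hk₁]
    push_cast
    linarith
  have hrq : r ≤ q := by
    have := Int.le_ceil (a / q)
    rw [div_le_iff₀ hq] at this
    rw [hr, hk₁]
    push_cast
    linarith
  have hsum : ∑ l ∈ apWindow q a 0 M, √(a - q * l) ^ 3 =
      ∑ j ∈ Finset.range ⌈(M - r) / q⌉₊, √(r + q * j) ^ 3 := by
    refine Finset.sum_nbij' (fun l => (k₁ - l).toNat) (fun j => k₁ - j) ?_ ?_ ?_ ?_ ?_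
    all_goals
      have hle : ∀ l ∈ apWindow q a 0 M, l ≤ k₁ := by
        intro l hl
        have h1 := ((mem_apWindow hq).mp hl).1
        have h2 : (l : ℝ) < a / q := by rw [lt_div_iff₀ hq]; linarith
        have := Int.lt_ceil.mpr h2
        omega
      have hcast : ∀ l ∈ apWindow q a 0 M, (((k₁ - l).toNat : ℕ) : ℝ) = k₁ - l := by
        intro l hl
        have : (((k₁ - l).toNat : ℕ) : ℤ) = k₁ - l :=
          Int.toNat_of_nonneg (by linarith [hle l hl])
        exact_mod_cast this
    · intro l hl
      rw [Finset.mem_range, Nat.lt_ceil, lt_div_iff₀ hq, hcast l hl]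
      linarith [((mem_apWindow hq).mp hl).2]
    · intro j hj
      rw [Finset.mem_range, Nat.lt_ceil, lt_div_iff₀ hq] at hj
      rw [mem_apWindow hq]
      push_cast
      have : 0 ≤ q * (j : ℝ) := by positivity
      constructor <;> linarith
    · intro l hl
      rw [Int.toNat_of_nonneg (by linarith [hle l hl])]
      ring
    · intro j hj
      simp
    · intro l hl
      rw [hcast l hl, hr]
      congr 2
      ring
  rw [hsum]
  have h := abs_sum_range_sqrt_sub_le hq hrq hM
  set s := ∑ j ∈ Finset.range ⌈(M - r) / q⌉₊, √(r + q * j) ^ 3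
  have e : q * s - 2 / 5 * √M ^ 5 = q * (s - 2 / 5 * √M ^ 5 / q) := by
    field_simp
  rw [e, abs_mul, abs_of_pos hq] at h
  exact le_of_mul_le_mul_left h hq

/-- Pairs `(c, d)` in a residue class modulo `m`, with `I` in an interval and `|J| < w(I)`. -/
def residueRegion (n b : ℤ) (m : ℕ) (σ : ZMod m × ZMod m) (α β : ℝ) (w : ℝ → ℝ) :
    Set (ℤ × ℤ) :=
  {v | ((v.1 : ZMod m), (v.2 : ZMod m)) = σ ∧ α < (Iform n b v.1 : ℝ) ∧
    (Iform n b v.1 : ℝ) < β ∧ |(Jform n b v.1 v.2 : ℝ)| < w (Iform n b v.1)}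

/-- The number of points in a region, up to the number of admissible `c`. -/
theorem abs_ncard_residueRegion_sub_le {n : ℤ} (hn : 0 < n) (b : ℤ) {m : ℕ} (hm : 0 < m)
    (σ : ZMod m × ZMod m) {α β : ℝ} (hαβ : α ≤ β) {w : ℝ → ℝ} (hw : ∀ x, 0 ≤ w x) :
    ∃ a : ℝ, (residueRegion n b m σ α β w).Finite ∧
    |((residueRegion n b m σ α β w).ncard : ℝ) -
      ∑ k ∈ apWindow (3 * n * m) a α β, 2 * w (a - 3 * n * m * k) / (27 * n ^ 2 * m)| ≤
      (β - α) / (3 * n * m) + 1 := by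
  obtain ⟨c₀, hc₀⟩ := ZMod.intCast_surjective σ.1
  obtain ⟨d₀, hd₀⟩ := ZMod.intCast_surjective σ.2
  have hmR : (0 : ℝ) < m := by exact_mod_cast hm
  have hnR : (0 : ℝ) < n := by exact_mod_cast hn
  have hmZ : (m : ℤ) ≠ 0 := by exact_mod_cast hm.ne'
  have hq : (0 : ℝ) < 3 * n * m := by positivity
  have hq' : (0 : ℝ) < 27 * n ^ 2 * m := by positivity
  set a : ℝ := ((Iform n b c₀ : ℤ) : ℝ) with ha
  have hI : ∀ k : ℤ, (Iform n b (c₀ + m * k) : ℝ) = a - 3 * n * m * k := by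
    intro k
    rw [ha]
    simp only [Iform]
    push_cast
    ring
  have hJ : ∀ k l : ℤ, (Jform n b (c₀ + m * k) (d₀ + m * l) : ℝ) =
      Jform n b (c₀ + m * k) d₀ - 27 * n ^ 2 * m * l := by
    intro k l
    simp only [Jform]
    push_cast
    ring
  let W : ℤ → Finset ℤ := fun k =>
    apWindow (27 * n ^ 2 * m) (Jform n b (c₀ + m * k) d₀)
      (-(w (a - 3 * n * m * k))) (w (a - 3 * n * m * k))
  let T : Finset (Σ _ : ℤ, ℤ) := (apWindow (3 * n * m) a α β).sigma W
  let φ : (Σ _ : ℤ, ℤ) → ℤ × ℤ := fun p => (c₀ + m * p.1, d₀ + m * p.2)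
  have hφ : Function.Injective φ := by
    rintro ⟨k, l⟩ ⟨k', l'⟩ h
    simp only [φ, Prod.mk.injEq, add_right_inj, mul_right_inj' hmZ] at h
    rw [h.1, h.2]
  have himg : residueRegion n b m σ α β w = φ '' (T : Set (Σ _ : ℤ, ℤ)) := by
    ext ⟨c, d⟩
    simp only [residueRegion, Set.mem_ofPred_eq, Set.mem_image, Finset.mem_coe]
    constructor
    · rintro ⟨h1, h2, h3, h4⟩
      rw [← h1] at hc₀ hd₀
      obtain ⟨k, hk⟩ := (ZMod.intCast_eq_intCast_iff_dvd_sub c₀ c m).mp hc₀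
      obtain ⟨l, hl⟩ := (ZMod.intCast_eq_intCast_iff_dvd_sub d₀ d m).mp hd₀
      obtain rfl : c = c₀ + m * k := by linarith
      obtain rfl : d = d₀ + m * l := by linarith
      rw [hI] at h2 h3 h4
      rw [hJ, abs_lt] at h4
      exact ⟨⟨k, l⟩, Finset.mem_sigma.mpr ⟨(mem_apWindow hq).mpr ⟨h2, h3⟩,
        (mem_apWindow hq').mpr h4⟩, rfl⟩
    · rintro ⟨⟨k, l⟩, hkl, h⟩
      obtain ⟨h1, h2⟩ := Finset.mem_sigma.mp hkl
      obtain ⟨rfl, rfl⟩ := Prod.mk.inj h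
      rw [hI, hJ, abs_lt]
      refine ⟨Prod.ext ?_ ?_, ((mem_apWindow hq).mp h1).1, ((mem_apWindow hq).mp h1).2,
        (mem_apWindow hq').mp h2⟩
      · simp [hc₀]
      · simp [hd₀]
  refine ⟨a, by rw [himg]; exact T.finite_toSet.image _, ?_⟩
  rw [himg, Set.ncard_image_of_injective _ hφ, Set.ncard_coe_finset, Finset.card_sigma]
  push_cast
  rw [← Finset.sum_sub_distrib]
  refine (Finset.abs_sum_le_sum_abs _ _).trans ?_
  have h1 : ∀ k ∈ apWindow (3 * n * m) a α β,
      |((W k).card : ℝ) - 2 * w (a - 3 * n * m * k) / (27 * n ^ 2 * m)| ≤ 1 := by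
    intro k _
    have := abs_card_apWindow_sub_le hq' (Jform n b (c₀ + m * k) d₀ : ℝ)
      (show -(w (a - 3 * n * m * k)) ≤ w (a - 3 * n * m * k) by
        linarith [hw (a - 3 * n * m * k)])
    rwa [sub_neg_eq_add, ← two_mul] at this
  refine (Finset.sum_le_sum h1).trans ?_
  rw [Finset.sum_const, nsmul_eq_mul, mul_one]
  have := (abs_le.mp (abs_card_apWindow_sub_le hq a hαβ)).2
  linarith

theorem exists_abs_ncard_posRegion_sub_le {n : ℤ} (b : ℤ) {m : ℕ} (hm : 0 < m)
    {ρ : ℝ} (hρ : 0 < ρ) (hρn : ρ ^ 3 = n) :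
    ∃ κ : ℝ, 0 ≤ κ ∧ ∀ Z : ℝ, 1 ≤ Z → ∀ σ : ZMod m × ZMod m,
      (residueRegion n b m σ 0 (ρ ^ 2 * Z ^ 2) fun x => 2 * √x ^ 3).Finite ∧
      |((residueRegion n b m σ 0 (ρ ^ 2 * Z ^ 2) fun x => 2 * √x ^ 3).ncard : ℝ) -
        8 / (405 * ρ ^ 4) / m ^ 2 * Z ^ 5| ≤ κ * Z ^ 3 := by
  have hmR : (0 : ℝ) < m := by exact_mod_cast hm
  have hnR : (0 : ℝ) < n := by rw [← hρn]; positivity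
  have hn : 0 < n := by exact_mod_cast hnR
  have hq : (0 : ℝ) < 3 * n * m := by positivity
  refine ⟨ρ ^ 2 / (3 * n * m) + 1 + 4 / (27 * n ^ 2 * m) * √(ρ ^ 2 + 3 * n * m) ^ 3,
    by positivity, fun Z hZ σ => ?_⟩
  have hZ0 : 0 < Z := by linarith
  have hM : 0 ≤ ρ ^ 2 * Z ^ 2 := by positivity
  obtain ⟨a, hfin, h⟩ := abs_ncard_residueRegion_sub_le hn b hm σ hM
    (w := fun x => 2 * √x ^ 3) (fun x => by positivity)
  refine ⟨hfin, ?_⟩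
  have hs := abs_sum_apWindow_sqrt_sub_le hq hM a
  have hsM : √(ρ ^ 2 * Z ^ 2) = ρ * Z := by
    rw [← mul_pow]; exact Real.sqrt_sq (by positivity)
  have hsum : ∑ k ∈ apWindow (3 * n * m) a 0 (ρ ^ 2 * Z ^ 2),
      2 * (2 * √(a - 3 * n * m * k) ^ 3) / (27 * (n : ℝ) ^ 2 * m) =
      4 / (27 * n ^ 2 * m) * ∑ k ∈ apWindow (3 * n * m) a 0 (ρ ^ 2 * Z ^ 2),
        √(a - 3 * n * m * k) ^ 3 := by
    rw [Finset.mul_sum]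
    exact Finset.sum_congr rfl fun k _ => by ring
  rw [hsum] at h
  rw [hsM] at hs
  set s := ∑ k ∈ apWindow (3 * n * m) a 0 (ρ ^ 2 * Z ^ 2), √(a - 3 * n * m * k) ^ 3
  have hmain : 4 / (27 * (n : ℝ) ^ 2 * m) * (2 / 5 * (ρ * Z) ^ 5 / (3 * n * m)) =
      8 / (405 * ρ ^ 4) / m ^ 2 * Z ^ 5 := by
    rw [← hρn]
    field_simp
    norm_num
  have hbound : √(ρ ^ 2 * Z ^ 2 + 3 * n * m) ^ 3 ≤ √(ρ ^ 2 + 3 * n * m) ^ 3 * Z ^ 3 := by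
    have h1 : √(ρ ^ 2 * Z ^ 2 + 3 * n * m) ≤ √(ρ ^ 2 + 3 * n * m) * Z := by
      rw [← Real.sqrt_sq hZ0.le, ← Real.sqrt_mul (by positivity), Real.sqrt_sq hZ0.le]
      refine Real.sqrt_le_sqrt ?_
      have : (1 : ℝ) ≤ Z ^ 2 := one_le_pow₀ hZ
      nlinarith
    rw [← mul_pow (√(ρ ^ 2 + 3 * n * m))]
    gcongr
  have h2 : |4 / (27 * (n : ℝ) ^ 2 * m) * s - 8 / (405 * ρ ^ 4) / m ^ 2 * Z ^ 5| ≤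
      4 / (27 * n ^ 2 * m) * (√(ρ ^ 2 + 3 * n * m) ^ 3 * Z ^ 3) := by
    rw [← hmain, ← mul_sub, abs_mul,
      abs_of_nonneg (show (0 : ℝ) ≤ 4 / (27 * (n : ℝ) ^ 2 * m) by positivity)]
    exact mul_le_mul_of_nonneg_left (hs.trans hbound) (by positivity)
  have h3 : (ρ ^ 2 * Z ^ 2 - 0) / (3 * n * m) + 1 ≤ (ρ ^ 2 / (3 * n * m) + 1) * Z ^ 3 := by
    have e1 : Z ^ 2 ≤ Z ^ 3 := pow_le_pow_right₀ hZ (by norm_num)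
    have e2 : 1 ≤ Z ^ 3 := one_le_pow₀ hZ
    have e3 : ρ ^ 2 / (3 * n * m) * Z ^ 2 ≤ ρ ^ 2 / (3 * n * m) * Z ^ 3 := by gcongr
    rw [sub_zero, mul_div_right_comm]
    linarith
  calc _ ≤ _ := abs_sub_le _ (4 / (27 * (n : ℝ) ^ 2 * m) * s) _
    _ ≤ _ := add_le_add (h.trans h3) h2
    _ = _ := by ring

theorem exists_abs_ncard_boxRegion_sub_le {n : ℤ} (b : ℤ) {m : ℕ} (hm : 0 < m)
    {ρ : ℝ} (hρ : 0 < ρ) (hρn : ρ ^ 3 = n) :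
    ∃ κ : ℝ, 0 ≤ κ ∧ ∀ Z : ℝ, 1 ≤ Z → ∀ σ : ZMod m × ZMod m,
      (residueRegion n b m σ (-(ρ ^ 2 * Z ^ 2)) (ρ ^ 2 * Z ^ 2)
        fun _ => 2 * ρ ^ 3 * Z ^ 3).Finite ∧
      |((residueRegion n b m σ (-(ρ ^ 2 * Z ^ 2)) (ρ ^ 2 * Z ^ 2)
        fun _ => 2 * ρ ^ 3 * Z ^ 3).ncard : ℝ) -
        40 / (405 * ρ ^ 4) / m ^ 2 * Z ^ 5| ≤ κ * Z ^ 3 := by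
  have hmR : (0 : ℝ) < m := by exact_mod_cast hm
  have hnR : (0 : ℝ) < n := by rw [← hρn]; positivity
  have hn : 0 < n := by exact_mod_cast hnR
  have hq : (0 : ℝ) < 3 * n * m := by positivity
  refine ⟨2 * ρ ^ 2 / (3 * n * m) + 1 + 4 * ρ ^ 3 / (27 * n ^ 2 * m),
    by positivity, fun Z hZ σ => ?_⟩
  have hZ0 : 0 < Z := by linarith
  have hM : -(ρ ^ 2 * Z ^ 2) ≤ ρ ^ 2 * Z ^ 2 := by
    have : 0 ≤ ρ ^ 2 * Z ^ 2 := by positivity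
    linarith
  obtain ⟨a, hfin, h⟩ := abs_ncard_residueRegion_sub_le hn b hm σ hM
    (w := fun _ => 2 * ρ ^ 3 * Z ^ 3) (fun x => by positivity)
  refine ⟨hfin, ?_⟩
  have hs := abs_card_apWindow_sub_le hq a hM
  rw [Finset.sum_const, nsmul_eq_mul] at h
  set s := ((apWindow (3 * n * m) a (-(ρ ^ 2 * Z ^ 2)) (ρ ^ 2 * Z ^ 2)).card : ℝ)
  have hmain : (ρ ^ 2 * Z ^ 2 - -(ρ ^ 2 * Z ^ 2)) / (3 * n * m) *
      (2 * (2 * ρ ^ 3 * Z ^ 3) / (27 * (n : ℝ) ^ 2 * m)) =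
      40 / (405 * ρ ^ 4) / m ^ 2 * Z ^ 5 := by
    rw [← hρn]
    field_simp
    norm_num
  have h2 : |s * (2 * (2 * ρ ^ 3 * Z ^ 3) / (27 * (n : ℝ) ^ 2 * m)) -
      40 / (405 * ρ ^ 4) / m ^ 2 * Z ^ 5| ≤
      1 * (2 * (2 * ρ ^ 3 * Z ^ 3) / (27 * (n : ℝ) ^ 2 * m)) := by
    rw [← hmain, ← sub_mul, abs_mul]
    rw [abs_of_nonneg (show 0 ≤ 2 * (2 * ρ ^ 3 * Z ^ 3) / (27 * (n : ℝ) ^ 2 * m) by positivity)]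
    gcongr
  have h3 : (ρ ^ 2 * Z ^ 2 - -(ρ ^ 2 * Z ^ 2)) / (3 * n * m) + 1 ≤
      (2 * ρ ^ 2 / (3 * n * m) + 1) * Z ^ 3 := by
    have e1 : Z ^ 2 ≤ Z ^ 3 := pow_le_pow_right₀ hZ (by norm_num)
    have e2 : 1 ≤ Z ^ 3 := one_le_pow₀ hZ
    have e3 : 2 * ρ ^ 2 / (3 * n * m) * Z ^ 2 ≤ 2 * ρ ^ 2 / (3 * n * m) * Z ^ 3 := by gcongr
    have e4 : (ρ ^ 2 * Z ^ 2 - -(ρ ^ 2 * Z ^ 2)) / (3 * n * m) =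
      2 * ρ ^ 2 / (3 * n * m) * Z ^ 2 := by ring
    rw [e4]
    linarith
  calc _ ≤ _ := abs_sub_le _ (s * (2 * (2 * ρ ^ 3 * Z ^ 3) / (27 * (n : ℝ) ^ 2 * m))) _
    _ ≤ _ := add_le_add (h.trans h3) h2
    _ = _ := by ring

theorem abs_ncard_preimage_sub_le {V ι : Type*} [Finite ι] (f : V → ι) (Q : V → Prop)
    (S : Set ι) {μ e : ℝ} (h : ∀ σ, {v | f v = σ ∧ Q v}.Finite ∧
      |({v | f v = σ ∧ Q v}.ncard : ℝ) - μ| ≤ e) :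
    {v | f v ∈ S ∧ Q v}.Finite ∧ |({v | f v ∈ S ∧ Q v}.ncard : ℝ) - S.ncard * μ| ≤
      S.ncard * e := by
  classical
  have hS : S.Finite := Set.toFinite S
  have hfin : {v | f v ∈ S ∧ Q v}.Finite := by
    refine (hS.biUnion fun σ _ => (h σ).1).subset fun v hv => ?_
    exact Set.mem_biUnion hv.1 ⟨rfl, hv.2⟩
  refine ⟨hfin, ?_⟩
  have hmaps : ∀ v ∈ hfin.toFinset, f v ∈ hS.toFinset := fun v hv => by
    rw [Set.Finite.mem_toFinset] at hv ⊢
    exact hv.1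
  have hfib : ∀ σ ∈ hS.toFinset,
      (hfin.toFinset.filter fun v => f v = σ).card = {v | f v = σ ∧ Q v}.ncard := by
    intro σ hσ
    rw [Set.Finite.mem_toFinset] at hσ
    rw [← Set.ncard_coe_finset]
    congr 1
    ext v
    simp only [Finset.coe_filter, Set.Finite.mem_toFinset, Set.mem_ofPred_eq]
    constructor
    · rintro ⟨h1, h2⟩
      exact ⟨h2, h1.2⟩
    · rintro ⟨rfl, h2⟩
      exact ⟨⟨hσ, h2⟩, rfl⟩
  rw [Set.ncard_eq_toFinset_card _ hfin, Set.ncard_eq_toFinset_card _ hS,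
    Finset.card_eq_sum_card_fiberwise hmaps, Finset.sum_congr rfl hfib]
  push_cast
  have e1 : ∀ x : ℝ, (hS.toFinset.card : ℝ) * x = ∑ _σ ∈ hS.toFinset, x := fun x => by
    rw [Finset.sum_const, nsmul_eq_mul]
  rw [e1, e1, ← Finset.sum_sub_distrib]
  exact (Finset.abs_sum_le_sum_abs _ _).trans (Finset.sum_le_sum fun σ _ => (h σ).2)

theorem exists_coeff_bound {n : ℤ} (hn : 0 < n) (b : ℤ) {ρ : ℝ} (hρ : 0 < ρ) :
    ∃ A : ℝ, 1 ≤ A ∧ ∀ Z : ℝ, 1 ≤ Z → ∀ c d : ℤ,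
      |(Iform n b c : ℝ)| < ρ ^ 2 * Z ^ 2 → |(Jform n b c d : ℝ)| < 2 * ρ ^ 3 * Z ^ 3 →
      |(c : ℝ)| ≤ A * Z ^ 2 ∧ |(d : ℝ)| ≤ A * Z ^ 3 := by
  have hn1 : (1 : ℝ) ≤ n := by exact_mod_cast hn
  set A₁ : ℝ := (b : ℝ) ^ 2 + ρ ^ 2 with hA₁
  set A₂ : ℝ := 2 * |(b : ℝ)| ^ 3 + 9 * n * |(b : ℝ)| * A₁ + 2 * ρ ^ 3 with hA₂
  have h1 : 0 ≤ A₁ := by positivity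
  have h2 : 0 ≤ A₂ := by positivity
  refine ⟨A₁ + A₂ + 1, by linarith, fun Z hZ c d hI hJ => ?_⟩
  have hZ0 : 0 < Z := by linarith
  have hZ2 : 1 ≤ Z ^ 2 := one_le_pow₀ hZ
  have hZ3 : 1 ≤ Z ^ 3 := one_le_pow₀ hZ
  have hZ23 : Z ^ 2 ≤ Z ^ 3 := pow_le_pow_right₀ hZ (by norm_num)
  have hc : |(c : ℝ)| ≤ A₁ * Z ^ 2 := by
    have e1 : (3 * n : ℝ) * c = b ^ 2 - Iform n b c := by
      simp only [Iform]; push_cast; ring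
    have e2 : (3 * n : ℝ) * |(c : ℝ)| ≤ A₁ * Z ^ 2 := by
      have e2 : (3 * n : ℝ) * |(c : ℝ)| = |(3 * n : ℝ) * c| := by
        rw [abs_mul, abs_of_nonneg (show (0 : ℝ) ≤ 3 * n by linarith)]
      rw [e2, e1]
      refine (abs_sub _ _).trans ?_
      rw [abs_of_nonneg (sq_nonneg (b : ℝ)), hA₁]
      nlinarith [sq_nonneg (b : ℝ)]
    nlinarith [abs_nonneg (c : ℝ)]
  have hd : |(d : ℝ)| ≤ A₂ * Z ^ 3 := by
    have hn2 : (1 : ℝ) ≤ 27 * (n : ℝ) ^ 2 := by nlinarith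
    have e1 : (27 * (n : ℝ) ^ 2) * d = -2 * b ^ 3 + 9 * n * b * c - Jform n b c d := by
      simp only [Jform]; push_cast; ring
    have e2 : (27 * (n : ℝ) ^ 2) * |(d : ℝ)| ≤ A₂ * Z ^ 3 := by
      calc (27 * (n : ℝ) ^ 2) * |(d : ℝ)| = |(27 * (n : ℝ) ^ 2) * d| := by
            rw [abs_mul, abs_of_nonneg (by positivity : (0 : ℝ) ≤ 27 * (n : ℝ) ^ 2)]
        _ ≤ |-2 * (b : ℝ) ^ 3| + |9 * (n : ℝ) * b * c| + |(Jform n b c d : ℝ)| := by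
            rw [e1]
            exact (abs_sub _ _).trans (add_le_add (abs_add_le _ _) le_rfl)
        _ = 2 * |(b : ℝ)| ^ 3 + 9 * n * |(b : ℝ)| * |(c : ℝ)| + |(Jform n b c d : ℝ)| := by
            simp only [abs_mul, abs_neg, abs_pow, abs_of_nonneg (by linarith : (0 : ℝ) ≤ n)]
            norm_num
        _ ≤ 2 * |(b : ℝ)| ^ 3 * Z ^ 3 + 9 * n * |(b : ℝ)| * (A₁ * Z ^ 3) +
            2 * ρ ^ 3 * Z ^ 3 := by
            have f1 : 2 * |(b : ℝ)| ^ 3 ≤ 2 * |(b : ℝ)| ^ 3 * Z ^ 3 :=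
              le_mul_of_one_le_right (by positivity) hZ3
            have f2 : |(c : ℝ)| ≤ A₁ * Z ^ 3 :=
              hc.trans (mul_le_mul_of_nonneg_left hZ23 h1)
            have f3 : 9 * n * |(b : ℝ)| * |(c : ℝ)| ≤ 9 * n * |(b : ℝ)| * (A₁ * Z ^ 3) :=
              mul_le_mul_of_nonneg_left f2 (by positivity)
            linarith
        _ = A₂ * Z ^ 3 := by rw [hA₂]; ring
    nlinarith [abs_nonneg (d : ℝ)]
  constructor <;> nlinarith

/-- Few forms of bounded height are not generic or have vanishing discriminant. -/
theorem exists_card_nongeneric_le {n : ℤ} (hn : 0 < n) (b : ℤ) {ρ : ℝ} (hρ : 0 < ρ) :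
    ∃ K : ℝ, 0 ≤ K ∧ ∀ Z : ℝ, 1 ≤ Z → ∀ T : Set (ℤ × ℤ), T.Finite →
      (∀ v ∈ T, |(Iform n b v.1 : ℝ)| < ρ ^ 2 * Z ^ 2 ∧
        |(Jform n b v.1 v.2 : ℝ)| < 2 * ρ ^ 3 * Z ^ 3 ∧
        (GenericForm n b v.1 v.2 → discForm n b v.1 v.2 = 0)) →
      (T.ncard : ℝ) ≤ K * Z ^ 3 := by
  classical
  obtain ⟨A, hA, hbound⟩ := exists_coeff_bound hn b hρ
  obtain ⟨K₁, h₁⟩ := card_le_of_root hn.ne' b hA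
  obtain ⟨K₂, h₂⟩ := card_le_of_isSquare hn.ne' b hA
  have hmain : ∀ Z : ℝ, 1 ≤ Z → ∀ T : Set (ℤ × ℤ), T.Finite →
      (∀ v ∈ T, |(Iform n b v.1 : ℝ)| < ρ ^ 2 * Z ^ 2 ∧
        |(Jform n b v.1 v.2 : ℝ)| < 2 * ρ ^ 3 * Z ^ 3 ∧
        (GenericForm n b v.1 v.2 → discForm n b v.1 v.2 = 0)) →
      (T.ncard : ℝ) ≤ (K₁ + K₂) * Z ^ 3 := by
    intro Z hZ T hT h
    set U := hT.toFinset with hU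
    have hUb : ∀ v ∈ U, |(v.1 : ℝ)| ≤ A * Z ^ 2 ∧ |(v.2 : ℝ)| ≤ A * Z ^ 3 := fun v hv => by
      have := h v ((Set.Finite.mem_toFinset hT).mp hv)
      exact hbound Z hZ v.1 v.2 this.1 this.2.1
    have hUcov : U ⊆ (U.filter fun v => ∃ t : ℤ,
        t ^ 3 + b * t ^ 2 + v.1 * n * t + v.2 * n ^ 2 = 0) ∪
        U.filter fun v => IsSquare (discForm n b v.1 v.2) := by
      intro v hv
      rw [Finset.mem_union, Finset.mem_filter, Finset.mem_filter]
      by_contra! hcon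
      obtain ⟨hr, hs⟩ := hcon
      have hs' := hs hv
      have := (h v ((Set.Finite.mem_toFinset hT).mp hv)).2.2
        (genericForm_of_not_root_of_not_isSquare hn.ne' (hr hv) hs')
      exact hs' (this ▸ IsSquare.zero)
    have hcard := (Finset.card_le_card hUcov).trans (Finset.card_union_le _ _)
    rw [Set.ncard_eq_toFinset_card _ hT, add_mul]
    refine (Nat.cast_le.mpr hcard).trans ?_
    push_cast
    refine add_le_add (h₁ Z hZ _ ?_ ?_) (h₂ Z hZ _ ?_ ?_)
    · exact fun v hv => hUb v (Finset.mem_filter.mp hv).1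
    · exact fun v hv => (Finset.mem_filter.mp hv).2
    · exact fun v hv => (hUb v (Finset.mem_filter.mp hv).1).1
    · exact fun v hv => (Finset.mem_filter.mp hv).2
  refine ⟨K₁ + K₂, ?_, hmain⟩
  have := hmain 1 le_rfl ∅ Set.finite_empty (by simp)
  simpa using this

theorem htForm_lt_iff {n : ℤ} (b c d : ℤ) {ρ Z : ℝ} (hρ : 0 < ρ) (hρn : ρ ^ 3 = n)
    (hZ : 0 < Z) : htForm n b c d < Z ^ 6 ↔
      |(Iform n b c : ℝ)| < ρ ^ 2 * Z ^ 2 ∧ |(Jform n b c d : ℝ)| < 2 * ρ ^ 3 * Z ^ 3 := by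
  rw [htForm, ← hρn, inv_mul_lt_iff₀ (by positivity), max_lt_iff]
  refine and_congr ?_ ?_
  · rw [show (ρ ^ 3) ^ 2 * Z ^ 6 = (ρ ^ 2 * Z ^ 2) ^ 3 by ring]
    exact pow_lt_pow_iff_left₀ (abs_nonneg _) (by positivity) (by norm_num)
  · rw [div_lt_iff₀ (by norm_num), ← sq_abs,
      show (ρ ^ 3) ^ 2 * Z ^ 6 * 4 = (2 * ρ ^ 3 * Z ^ 3) ^ 2 by ring]
    exact pow_lt_pow_iff_left₀ (abs_nonneg _) (by positivity) (by norm_num)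

theorem discForm_pos_iff {n : ℤ} (hn : 0 < n) (b c d : ℤ) :
    0 < discForm n b c d ↔ 0 < (Iform n b c : ℝ) ∧
      |(Jform n b c d : ℝ)| < 2 * √(Iform n b c : ℝ) ^ 3 := by
  have h := twenty_seven_mul_discForm n b c d
  have h' : 27 * (n : ℝ) ^ 2 * discForm n b c d =
      4 * (Iform n b c : ℝ) ^ 3 - (Jform n b c d : ℝ) ^ 2 := by exact_mod_cast h
  have hnR : (0 : ℝ) < n := by exact_mod_cast hn
  have h1 : 0 < discForm n b c d ↔ (Jform n b c d : ℝ) ^ 2 < 4 * (Iform n b c : ℝ) ^ 3 := by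
    rw [← sub_pos (b := (Jform n b c d : ℝ) ^ 2), ← h', mul_pos_iff_of_pos_left (by positivity), Int.cast_pos]
  rw [h1]
  have h2 : ∀ x : ℝ, 0 ≤ x → (2 * √x ^ 3) ^ 2 = 4 * x ^ 3 := fun x hx => by
    rw [mul_pow, ← pow_mul, mul_comm 3 2, pow_mul, Real.sq_sqrt hx]
    norm_num
  constructor
  · intro h3
    have hI : 0 < (Iform n b c : ℝ) := by
      by_contra! hcon
      have : (Iform n b c : ℝ) ^ 3 ≤ 0 := Odd.pow_nonpos (by decide) hcon
      nlinarith [sq_nonneg (Jform n b c d : ℝ)]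
    refine ⟨hI, abs_lt_of_sq_lt_sq ?_ (by positivity)⟩
    rwa [h2 _ hI.le]
  · rintro ⟨hI, h3⟩
    rw [← h2 _ hI.le, ← sq_abs]
    gcongr

theorem abs_NCong_sub_le (n : ℕ) (hn : 0 < n) (b : ℤ) (m : ℕ) (hm : 0 < m)
    (S : Set (ZMod m × ZMod m)) {ρ : ℝ} (hρ : 0 < ρ) (hρn : ρ ^ 3 = n) :
    ∃ κ : ℝ, 0 < κ ∧ ∀ Z : ℝ, 1 ≤ Z →
      |(NCong n b m S 1 (Z ^ 6) : ℝ) -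
        8 / (405 * ρ ^ 4) * ((S.ncard : ℝ) / m ^ 2) * Z ^ 5| ≤ κ * Z ^ 3 ∧
      |(NCong n b m S (-1) (Z ^ 6) : ℝ) -
        32 / (405 * ρ ^ 4) * ((S.ncard : ℝ) / m ^ 2) * Z ^ 5| ≤ κ * Z ^ 3 := by
  have : NeZero m := ⟨hm.ne'⟩
  have hnZ : (0 : ℤ) < n := by exact_mod_cast hn
  have hρn' : ρ ^ 3 = ((n : ℤ) : ℝ) := by rw [hρn]; norm_num
  obtain ⟨κ₁, hκ₁, hpos⟩ := exists_abs_ncard_posRegion_sub_le b hm hρ hρn'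
  obtain ⟨κ₂, hκ₂, hbox⟩ := exists_abs_ncard_boxRegion_sub_le b hm hρ hρn'
  obtain ⟨K, hK, hexc⟩ := exists_card_nongeneric_le hnZ b hρ
  refine ⟨S.ncard * (κ₁ + κ₂) + K + 1, by positivity, fun Z hZ => ?_⟩
  have hZ0 : 0 < Z := by linarith
  let f : ℤ × ℤ → ZMod m × ZMod m := fun v => ((v.1 : ZMod m), (v.2 : ZMod m))
  obtain ⟨hPfin, hP⟩ := abs_ncard_preimage_sub_le f _ S (hpos Z hZ)
  obtain ⟨hBfin, hB⟩ := abs_ncard_preimage_sub_le f _ S (hbox Z hZ)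
  set P : Set (ℤ × ℤ) := {v | f v ∈ S ∧ 0 < (Iform n b v.1 : ℝ) ∧
    (Iform n b v.1 : ℝ) < ρ ^ 2 * Z ^ 2 ∧
    |(Jform n b v.1 v.2 : ℝ)| < 2 * √(Iform n b v.1 : ℝ) ^ 3} with hPdef
  set B : Set (ℤ × ℤ) := {v | f v ∈ S ∧ -(ρ ^ 2 * Z ^ 2) < (Iform n b v.1 : ℝ) ∧
    (Iform n b v.1 : ℝ) < ρ ^ 2 * Z ^ 2 ∧
    |(Jform n b v.1 v.2 : ℝ)| < 2 * ρ ^ 3 * Z ^ 3} with hBdef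
  have hBmem : ∀ v, v ∈ B ↔ f v ∈ S ∧ |(Iform n b v.1 : ℝ)| < ρ ^ 2 * Z ^ 2 ∧
      |(Jform n b v.1 v.2 : ℝ)| < 2 * ρ ^ 3 * Z ^ 3 := fun v => by
    rw [hBdef, Set.mem_ofPred_eq, abs_lt (a := (Iform n b v.1 : ℝ)), and_assoc]
  have hPmem : ∀ v, v ∈ P ↔ v ∈ B ∧ 0 < discForm n b v.1 v.2 := by
    intro v
    rw [hBmem, discForm_pos_iff hnZ, hPdef, Set.mem_ofPred_eq]
    constructor
    · rintro ⟨h1, h2, h3, h4⟩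
      refine ⟨⟨h1, by rwa [abs_of_pos h2], h4.trans_le ?_⟩, h2, h4⟩
      have : √(Iform n b v.1 : ℝ) ≤ ρ * Z := by
        rw [Real.sqrt_le_left (by positivity), mul_pow]
        exact h3.le
      calc 2 * √(Iform n b v.1 : ℝ) ^ 3 ≤ 2 * (ρ * Z) ^ 3 := by gcongr
        _ = _ := by ring
    · rintro ⟨⟨h1, h2, -⟩, h3, h4⟩
      exact ⟨h1, h3, (le_abs_self _).trans_lt h2, h4⟩
  have hPB : P ⊆ B := fun v hv => ((hPmem v).mp hv).1
  have hht : ∀ v : ℤ × ℤ, htForm n b v.1 v.2 < Z ^ 6 ↔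
      |(Iform n b v.1 : ℝ)| < ρ ^ 2 * Z ^ 2 ∧
      |(Jform n b v.1 v.2 : ℝ)| < 2 * ρ ^ 3 * Z ^ 3 := fun v =>
    htForm_lt_iff b v.1 v.2 hρ hρn' hZ0
  set G₁ : Set (ℤ × ℤ) := {t : ℤ × ℤ | ((t.1 : ZMod m), (t.2 : ZMod m)) ∈ S ∧
    GenericForm n b t.1 t.2 ∧ 0 < 1 * discForm n b t.1 t.2 ∧
    htForm n b t.1 t.2 < Z ^ 6} with hG₁
  set G₂ : Set (ℤ × ℤ) := {t : ℤ × ℤ | ((t.1 : ZMod m), (t.2 : ZMod m)) ∈ S ∧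
    GenericForm n b t.1 t.2 ∧ 0 < -1 * discForm n b t.1 t.2 ∧
    htForm n b t.1 t.2 < Z ^ 6} with hG₂
  have hG₁P : G₁ ⊆ P := by
    rintro v ⟨h1, -, h3, h4⟩
    rw [one_mul] at h3
    exact (hPmem v).mpr ⟨(hBmem v).mpr ⟨h1, (hht v).mp h4⟩, h3⟩
  have hG₂B : G₂ ⊆ B \ P := by
    rintro v ⟨h1, -, h3, h4⟩
    refine ⟨(hBmem v).mpr ⟨h1, (hht v).mp h4⟩, fun hv => ?_⟩
    have := ((hPmem v).mp hv).2
    linarith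
  have hE₁ : ((P \ G₁).ncard : ℝ) ≤ K * Z ^ 3 := by
    refine hexc Z hZ _ hPfin.sdiff ?_
    rintro v ⟨hv, hvG⟩
    obtain ⟨hvB, hd⟩ := (hPmem v).mp hv
    obtain ⟨h1, h2, h3⟩ := (hBmem v).mp hvB
    refine ⟨h2, h3, fun hg => absurd ?_ hvG⟩
    exact ⟨h1, hg, by rwa [one_mul], (hht v).mpr ⟨h2, h3⟩⟩
  have hE₂ : (((B \ P) \ G₂).ncard : ℝ) ≤ K * Z ^ 3 := by
    refine hexc Z hZ _ hBfin.sdiff.sdiff ?_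
    rintro v ⟨⟨hvB, hvP⟩, hvG⟩
    obtain ⟨h1, h2, h3⟩ := (hBmem v).mp hvB
    refine ⟨h2, h3, fun hg => ?_⟩
    by_contra hne
    rcases lt_or_gt_of_ne hne with hlt | hgt
    · exact hvG ⟨h1, hg, by linarith, (hht v).mpr ⟨h2, h3⟩⟩
    · exact hvP ((hPmem v).mpr ⟨hvB, hgt⟩)
  have c₁ : ((P \ G₁).ncard : ℝ) + G₁.ncard = P.ncard := by
    exact_mod_cast Set.ncard_sdiff_add_ncard_of_subset hG₁P hPfin
  have c₂ : (((B \ P) \ G₂).ncard : ℝ) + G₂.ncard = (B \ P).ncard := by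
    exact_mod_cast Set.ncard_sdiff_add_ncard_of_subset hG₂B hBfin.sdiff
  have c₃ : ((B \ P).ncard : ℝ) + P.ncard = B.ncard := by
    exact_mod_cast Set.ncard_sdiff_add_ncard_of_subset hPB hBfin
  have n₁ : (0 : ℝ) ≤ (P \ G₁).ncard := Nat.cast_nonneg _
  have n₂ : (0 : ℝ) ≤ ((B \ P) \ G₂).ncard := Nat.cast_nonneg _
  have hN₁ : NCong n b m S 1 (Z ^ 6) = G₁.ncard := rfl
  have hN₂ : NCong n b m S (-1) (Z ^ 6) = G₂.ncard := rfl
  have hZ3 : 0 ≤ Z ^ 3 := by positivity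
  have k₁ : 0 ≤ (S.ncard : ℝ) * (κ₁ * Z ^ 3) := by positivity
  have k₂ : 0 ≤ (S.ncard : ℝ) * (κ₂ * Z ^ 3) := by positivity
  have m₁ : 8 / (405 * ρ ^ 4) * ((S.ncard : ℝ) / m ^ 2) * Z ^ 5 =
      S.ncard * (8 / (405 * ρ ^ 4) / m ^ 2 * Z ^ 5) := by ring
  have m₂ : 32 / (405 * ρ ^ 4) * ((S.ncard : ℝ) / m ^ 2) * Z ^ 5 =
      S.ncard * (40 / (405 * ρ ^ 4) / m ^ 2 * Z ^ 5) -
      S.ncard * (8 / (405 * ρ ^ 4) / m ^ 2 * Z ^ 5) := by ring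
  have r : (S.ncard * (κ₁ + κ₂) + K + 1) * Z ^ 3 =
      S.ncard * (κ₁ * Z ^ 3) + S.ncard * (κ₂ * Z ^ 3) + K * Z ^ 3 + Z ^ 3 := by ring
  rw [hN₁, hN₂, m₁, m₂, r]
  rw [abs_le] at hP hB
  constructor <;> rw [abs_le] <;> constructor <;> linarith

/-- Proposition 28 of the paper: fix `n ≥ 1`, `0 ≤ b < 3n`, and a
set `L ⊆ U_{n,b}(ℤ)` defined by congruence conditions modulo `m` on `(c, d)`, of
density `ν(L) = #S/m²`. Then for every `ε > 0` there is `κ > 0` such that for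
`X ≥ 1`, `N⁺(L; n, X) = (8/(405·n^{4/3}))·ν(L)·X^{5/6} + O_ε(X^{1/2+ε})` and
`N⁻(L; n, X) = (32/(405·n^{4/3}))·ν(L)·X^{5/6} + O_ε(X^{1/2+ε})`. -/
theorem count_forms_congruence_conditions (n : ℕ) (hn : 0 < n) (b : ℤ)
    (hb0 : 0 ≤ b) (hb : b < 3 * n) (m : ℕ) (hm : 0 < m)
    (S : Set (ZMod m × ZMod m)) (ε : ℝ) (hε : 0 < ε) :
    ∃ κ : ℝ, 0 < κ ∧ ∀ X : ℝ, 1 ≤ X →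
      |(NCong n b m S 1 X : ℝ) -
          (8 / (405 * (n : ℝ) ^ ((4 : ℝ) / 3))) * ((S.ncard : ℝ) / m ^ 2) *
            X ^ ((5 : ℝ) / 6)| ≤ κ * X ^ ((1 : ℝ) / 2 + ε) ∧
      |(NCong n b m S (-1) X : ℝ) -
          (32 / (405 * (n : ℝ) ^ ((4 : ℝ) / 3))) * ((S.ncard : ℝ) / m ^ 2) *
            X ^ ((5 : ℝ) / 6)| ≤ κ * X ^ ((1 : ℝ) / 2 + ε) := by
  have hnR : (0 : ℝ) < n := by exact_mod_cast hn
  have hρ : 0 < (n : ℝ) ^ ((1 : ℝ) / 3) := by positivity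
  have hpow : ∀ (x e : ℝ) (k : ℕ), 0 ≤ x → (x ^ e) ^ k = x ^ (e * k) := fun x e k hx => by
    rw [Real.rpow_mul hx, Real.rpow_natCast]
  have hρ3 : ((n : ℝ) ^ ((1 : ℝ) / 3)) ^ 3 = n := by
    rw [hpow _ _ _ hnR.le]
    norm_num
  have hρ4 : ((n : ℝ) ^ ((1 : ℝ) / 3)) ^ 4 = (n : ℝ) ^ ((4 : ℝ) / 3) := by
    rw [hpow _ _ _ hnR.le]
    norm_num
  obtain ⟨κ, hκ, h⟩ := abs_NCong_sub_le n hn b m hm S hρ hρ3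
  refine ⟨κ, hκ, fun X hX => ?_⟩
  have hX0 : 0 ≤ X := by linarith
  have hZ := h (X ^ ((1 : ℝ) / 6)) (Real.one_le_rpow hX (by norm_num))
  have e6 : (X ^ ((1 : ℝ) / 6)) ^ 6 = X := by
    rw [hpow _ _ _ hX0]
    norm_num
  have e5 : (X ^ ((1 : ℝ) / 6)) ^ 5 = X ^ ((5 : ℝ) / 6) := by
    rw [hpow _ _ _ hX0]
    norm_num
  have e3 : (X ^ ((1 : ℝ) / 6)) ^ 3 ≤ X ^ ((1 : ℝ) / 2 + ε) := by
    rw [hpow _ _ _ hX0]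
    exact Real.rpow_le_rpow_of_exponent_le hX (by norm_num; linarith)
  rw [e6, e5, hρ4] at hZ
  exact ⟨hZ.1.trans (by gcongr), hZ.2.trans (by gcongr)⟩
end
end

section
/- Fix a positive integer n. For every ε > 0, the number of M(ℤ)-orbits on U_n(ℤ) containing a form f with H(f) < X that is not generic is O_ε(X^{1/2+ε}), where the implied constant depends only on n and ε. -/
/-!
Statement 15: the number of `M(ℤ)`-orbits on `U_n(ℤ)` containing a non-generic form
of height `< X` is `O_ε(X^{1/2+ε})`.
-/

open Polynomial

noncomputable section

/-- The action of the lower-triangular unipotent matrix with parameter `k` on the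
coefficients `(b, c, d)` of `f ∈ U_n(ℤ)`:  `(k·f)(x,y) = f(x + ky, y)`. -/
def mAct (n : ℤ) (k : ℤ) : ℤ × ℤ × ℤ → ℤ × ℤ × ℤ :=
  fun t => (t.1 + 3 * n * k, t.2.1 + 2 * t.1 * k + 3 * n * k ^ 2,
    t.2.2 + t.2.1 * k + t.1 * k ^ 2 + n * k ^ 3)

/-- `M(ℤ)`-equivalence of forms in `U_n(ℤ)`, on coefficient triples `(b, c, d)`. -/
def mRel (n : ℤ) (t t' : ℤ × ℤ × ℤ) : Prop := ∃ k : ℤ, mAct n k t = t'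


theorem cubicPoly_eq_toPoly (n b c d : ℤ) :
    cubicPoly n b c d = (⟨n, b, c, d⟩ : Cubic ℚ).toPoly := rfl

theorem exists_depressed_int_root {n b c d : ℤ} {r : ℚ} (hr : (cubicPoly n b c d).IsRoot r) :
    ∃ y : ℤ, Jform n b c d = y ^ 3 - 3 * Iform n b c * y := by
  have h : (n : ℚ) * r ^ 3 + b * r ^ 2 + c * r + d = 0 := by
    simpa [cubicPoly, IsRoot] using hr
  have hint : IsIntegral ℤ (3 * n * r + b : ℚ) := by
    refine ⟨X ^ 3 - (C (3 * Iform n b c) * X + C (Jform n b c d)), ?_, ?_⟩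
    · apply monic_X_pow_sub
      compute_degree!
    · simp only [Iform, Jform, eval₂_sub, eval₂_add, eval₂_mul, eval₂_pow, eval₂_X, eval₂_C]
      push_cast
      simp
      linear_combination 27 * (n : ℚ) ^ 2 * h
  obtain ⟨y, hy⟩ := IsIntegrallyClosed.isIntegral_iff.mp hint
  refine ⟨y, ?_⟩
  have hy' : (y : ℚ) = 3 * n * r + b := hy
  have : (Jform n b c d : ℚ) = y ^ 3 - 3 * Iform n b c * y := by
    rw [hy']
    simp only [Iform, Jform]
    push_cast
    linear_combination - 27 * (n : ℚ) ^ 2 * h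
  exact_mod_cast this

theorem two_dvd_finrank_of_sq_eq {K : Type*} [Field K] [Algebra ℚ K] [FiniteDimensional ℚ K]
    {D : ℚ} {δ : K} (h : algebraMap ℚ K D = δ ^ 2) (hD : ¬ IsSquare D) :
    2 ∣ Module.finrank ℚ K := by
  have hirr : Irreducible (X ^ 2 - C D) := by
    apply irreducible_of_degree_le_three_of_not_isRoot
    · rw [natDegree_X_pow_sub_C]; decide
    · intro x hx
      apply hD
      refine ⟨x, ?_⟩
      have : x ^ 2 - D = 0 := by simpa [IsRoot] using hx
      linear_combination -this
  have hmin : X ^ 2 - C D = minpoly ℚ δ := by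
    apply minpoly.eq_of_irreducible_of_monic hirr
    · simp [h]
    · exact monic_X_pow_sub_C _ two_ne_zero
  have := minpoly.degree_dvd (K := ℚ) (L := K) (IsIntegral.of_finite ℚ δ)
  rwa [← hmin, natDegree_X_pow_sub_C] at this

theorem card_gal_le_factorial (p : ℚ[X]) : Nat.card p.Gal ≤ p.natDegree.factorial := by
  classical
  have : Fact ((p.map (algebraMap ℚ p.SplittingField)).Splits) := ⟨SplittingField.splits p⟩
  calc Nat.card p.Gal ≤ Nat.card (Equiv.Perm (p.rootSet p.SplittingField)) :=
        Nat.card_le_card_of_injective _ (Gal.galActionHom_injective p p.SplittingField)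
    _ = (p.rootSet p.SplittingField).ncard.factorial := by
        rw [Nat.card_perm]; rfl
    _ ≤ _ := Nat.factorial_le (ncard_rootSet_le p _)

theorem isSquare_discr_of_irreducible {n b c d : ℤ} (hn : n ≠ 0)
    (hirr : Irreducible (cubicPoly n b c d))
    (hrank : Module.finrank ℚ (cubicPoly n b c d).SplittingField ≠ 6) :
    ∃ m : ℤ, (Jform n b c d) ^ 2 + 3 * m ^ 2 = 4 * (Iform n b c) ^ 3 := by
  set P : Cubic ℚ := ⟨n, b, c, d⟩ with hP
  have hPn : P.a ≠ 0 := by simpa [hP] using hn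
  have hdeg : (cubicPoly n b c d).natDegree = 3 := by
    rw [cubicPoly_eq_toPoly]; exact Cubic.natDegree_of_a_ne_zero hPn
  have hcard := Gal.card_of_separable hirr.separable
  have h3 : 3 ∣ Module.finrank ℚ (cubicPoly n b c d).SplittingField := by
    have := Gal.prime_degree_dvd_card hirr (by rw [hdeg]; exact Nat.prime_three)
    rwa [hdeg, hcard] at this
  have hle : Module.finrank ℚ (cubicPoly n b c d).SplittingField ≤ 6 := by
    have := card_gal_le_factorial (cubicPoly n b c d)
    rwa [hdeg, hcard] at this
  have hpos : 0 < Module.finrank ℚ (cubicPoly n b c d).SplittingField := Module.finrank_pos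
  have hsq : IsSquare P.discr := by
    by_contra hns
    obtain ⟨x, y, z, hroots⟩ := (Cubic.splits_iff_roots_eq_three
      (φ := algebraMap ℚ (cubicPoly n b c d).SplittingField) hPn).mp
      (SplittingField.splits (cubicPoly n b c d))
    have := two_dvd_finrank_of_sq_eq (Cubic.discr_eq_prod_three_roots hPn hroots) hns
    omega
  have hdisc : P.discr = ((b ^ 2 * c ^ 2 - 4 * n * c ^ 3 - 4 * b ^ 3 * d - 27 * n ^ 2 * d ^ 2 +
      18 * n * b * c * d : ℤ) : ℚ) := by
    simp [hP, Cubic.discr]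
  rw [hdisc, Rat.isSquare_intCast_iff] at hsq
  obtain ⟨s, hs⟩ := hsq
  refine ⟨3 * n * s, ?_⟩
  simp only [Iform, Jform]
  linear_combination - 27 * (n : ℤ) ^ 2 * hs

theorem not_generic_imp {n b c d : ℤ} (hn : n ≠ 0) (h : ¬ GenericForm n b c d) :
    (∃ y : ℤ, Jform n b c d = y ^ 3 - 3 * Iform n b c * y) ∨
      ∃ m : ℤ, (Jform n b c d) ^ 2 + 3 * m ^ 2 = 4 * (Iform n b c) ^ 3 := by
  by_cases hirr : Irreducible (cubicPoly n b c d)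
  · exact .inr (isSquare_discr_of_irreducible hn hirr fun h6 => h ⟨hirr, h6⟩)
  · left
    have hPn : (⟨n, b, c, d⟩ : Cubic ℚ).a ≠ 0 := by simpa using hn
    have hdeg : (cubicPoly n b c d).natDegree = 3 := by
      rw [cubicPoly_eq_toPoly]; exact Cubic.natDegree_of_a_ne_zero hPn
    by_contra hno
    exact hirr (irreducible_of_degree_le_three_of_not_isRoot (by rw [hdeg]; decide)
      fun r hr => hno (exists_depressed_int_root hr))

/-- Linear growth in the exponent is dominated by `(p ^ ε) ^ a`, uniformly in `p ≥ 2`. -/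
theorem exists_succ_le_mul_rpow {ε : ℝ} (hε : 0 < ε) :
    ∃ C : ℝ, 1 ≤ C ∧ ∀ p a : ℕ, 2 ≤ p → ((a : ℝ) + 1) ≤ C * ((p : ℝ) ^ ε) ^ a := by
  have h2 : (1 : ℝ) < 2 ^ ε := Real.one_lt_rpow one_lt_two hε
  set s : ℝ := 2 ^ ε - 1 with hs
  have hspos : 0 < s := by linarith
  refine ⟨1 + s⁻¹, by linarith [inv_pos.mpr hspos], fun p a hp => ?_⟩
  have hp' : (2 : ℝ) ^ ε ≤ (p : ℝ) ^ ε :=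
    Real.rpow_le_rpow (by norm_num) (by exact_mod_cast hp) hε.le
  have hb : 1 + (a : ℝ) * s ≤ ((p : ℝ) ^ ε) ^ a :=
    (one_add_mul_le_pow (by linarith) a).trans
      (pow_le_pow_left₀ (by linarith) (by linarith) a)
  calc (a : ℝ) + 1 ≤ (1 + s⁻¹) * (1 + a * s) := by
        have : s⁻¹ * s = 1 := inv_mul_cancel₀ hspos.ne'
        have h1 : (1 + s⁻¹) * (1 + a * s) = 1 + a * s + s⁻¹ + a * (s⁻¹ * s) := by ring
        rw [h1, this]
        have := inv_pos.mpr hspos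
        have : 0 ≤ (a : ℝ) * s := by positivity
        linarith
    _ ≤ _ := mul_le_mul_of_nonneg_left hb (by positivity)

/-- The divisor bound: `d(n) = O_ε(n ^ ε)`. -/
theorem exists_card_divisors_le {ε : ℝ} (hε : 0 < ε) :
    ∃ C : ℝ, 0 < C ∧ ∀ n : ℕ, n ≠ 0 → (n.divisors.card : ℝ) ≤ C * (n : ℝ) ^ ε := by
  obtain ⟨C, hC1, hC⟩ := exists_succ_le_mul_rpow hε
  obtain ⟨B, hB⟩ := exists_nat_gt ((2 : ℝ) ^ ε⁻¹)
  refine ⟨C ^ B, by positivity, fun n hn => ?_⟩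
  have hfac : ∀ p ∈ n.primeFactors, ((n.factorization p : ℝ) + 1) ≤
      (if p < B then C else 1) * ((p : ℝ) ^ ε) ^ n.factorization p := by
    intro p hp
    have hp2 : 2 ≤ p := (Nat.prime_of_mem_primeFactors hp).two_le
    split_ifs with h
    · exact hC p _ hp2
    · have h2 : (2 : ℝ) ≤ (p : ℝ) ^ ε := by
        have : (2 : ℝ) ^ ε⁻¹ ≤ p := hB.le.trans (by exact_mod_cast not_lt.mp h)
        calc (2 : ℝ) = ((2 : ℝ) ^ ε⁻¹) ^ ε := by
              rw [← Real.rpow_mul (by norm_num), inv_mul_cancel₀ hε.ne', Real.rpow_one]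
          _ ≤ _ := Real.rpow_le_rpow (by positivity) this hε.le
      rw [one_mul]
      calc ((n.factorization p : ℝ) + 1) ≤ 2 ^ n.factorization p := by
            exact_mod_cast Nat.lt_two_pow_self
        _ ≤ _ := pow_le_pow_left₀ (by norm_num) h2 _
  have hprod : ∏ p ∈ n.primeFactors, ((p : ℝ) ^ ε) ^ n.factorization p = (n : ℝ) ^ ε := by
    conv_rhs => rw [← Nat.prod_factorization_pow_eq_self hn, Finsupp.prod]
    rw [Nat.cast_prod, ← Real.finsetProd_rpow _ _ (fun _ _ => by positivity)]
    refine Finset.prod_congr rfl fun p _ => ?_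
    rw [Nat.cast_pow, ← Real.rpow_natCast, ← Real.rpow_natCast, ← Real.rpow_mul (by positivity),
      ← Real.rpow_mul (by positivity), mul_comm]
  rw [Nat.card_divisors hn]
  push_cast
  calc ∏ p ∈ n.primeFactors, ((n.factorization p : ℝ) + 1)
      ≤ ∏ p ∈ n.primeFactors,
          ((if p < B then C else 1) * ((p : ℝ) ^ ε) ^ n.factorization p) :=
        Finset.prod_le_prod (fun _ _ => by positivity) hfac
    _ = (∏ p ∈ n.primeFactors, if p < B then C else 1) * (n : ℝ) ^ ε := by
        rw [Finset.prod_mul_distrib, hprod]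
    _ ≤ C ^ B * (n : ℝ) ^ ε := by
        gcongr
        rw [← Finset.prod_filter, Finset.prod_const]
        refine pow_le_pow_right₀ hC1 ?_
        calc _ ≤ (Finset.range B).card :=
              Finset.card_le_card fun p hp => by simpa using (Finset.mem_filter.mp hp).2
          _ = B := Finset.card_range B

theorem gcd_dvd_two_of_primitive {a b a₀ b₀ e f h : ℤ} (hb : IsCoprime b (a ^ 2 + 3 * b ^ 2))
    (hb₀ : IsCoprime b₀ (a ^ 2 + 3 * b ^ 2))
    (hef : e * f = a ^ 2 + 3 * b ^ 2) (he : e ∣ a * b₀ - a₀ * b) (hf : f ∣ a * b₀ + a₀ * b)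
    (hhe : h ∣ e) (hhf : h ∣ f) : h ∣ 2 := by
  have hhN : h ∣ a ^ 2 + 3 * b ^ 2 := hef ▸ hhe.mul_right f
  have hsq : h ^ 2 ∣ a ^ 2 + 3 * b ^ 2 := by
    rw [← hef, sq]; exact mul_dvd_mul hhe hhf
  have h1 : h ∣ 2 * a * b₀ := by
    obtain ⟨k, hk⟩ := dvd_add (hhe.trans he) (hhf.trans hf)
    exact ⟨k, by linear_combination hk⟩
  have h2 : h ∣ 2 * a := (hb₀.of_isCoprime_of_dvd_right hhN).symm.dvd_of_dvd_mul_right h1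
  have h3 : h ^ 2 ∣ 12 * b ^ 2 := by
    have : h ^ 2 ∣ (2 * a) ^ 2 := pow_dvd_pow_of_dvd h2 2
    obtain ⟨k, hk⟩ := dvd_sub (hsq.mul_left 4) this
    exact ⟨k, by linear_combination hk⟩
  have h4 : h ^ 2 ∣ 12 :=
    (IsCoprime.pow (hb.of_isCoprime_of_dvd_right hhN)).symm.dvd_of_dvd_mul_right h3
  have h5 : h.natAbs ^ 2 ∣ 12 := by
    have := Int.natAbs_dvd_natAbs.mpr h4
    simpa [Int.natAbs_pow] using this
  have h6 : h.natAbs ≤ 3 := by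
    by_contra! hc
    have := Nat.le_of_dvd (by norm_num) h5
    nlinarith
  have h7 : h.natAbs ∣ 2 := by
    interval_cases h.natAbs <;> revert h5 <;> decide
  exact Int.natAbs_dvd.mp (by exact_mod_cast h7)

theorem even_even_of_eight_dvd {a b : ℤ} (h : (8 : ℤ) ∣ a ^ 2 + 3 * b ^ 2) : 2 ∣ a ∧ 2 ∣ b := by
  have key : ∀ x y : ZMod 8, x ^ 2 + 3 * y ^ 2 = 0 → 4 * x = 0 ∧ 4 * y = 0 := by decide
  have h0 : ((a : ZMod 8)) ^ 2 + 3 * (b : ZMod 8) ^ 2 = 0 := by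
    have := (ZMod.intCast_zmod_eq_zero_iff_dvd (a ^ 2 + 3 * b ^ 2) 8).mpr (by exact_mod_cast h)
    simpa using this
  obtain ⟨ha, hb⟩ := key _ _ h0
  have ha' := (ZMod.intCast_zmod_eq_zero_iff_dvd (4 * a) 8).mp (by simpa using ha)
  have hb' := (ZMod.intCast_zmod_eq_zero_iff_dvd (4 * b) 8).mp (by simpa using hb)
  push_cast at ha' hb'
  omega

/-- Primitive representations of `N` by `a² + 3b²` that agree modulo `4` and have the same gcd
with `N` after pairing with a fixed primitive representation coincide. -/
theorem primitive_rep_injective {N a b a₁ b₁ a₀ b₀ : ℤ} (hN : 0 < N)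
    (h : a ^ 2 + 3 * b ^ 2 = N) (h₁ : a₁ ^ 2 + 3 * b₁ ^ 2 = N) (h₀ : a₀ ^ 2 + 3 * b₀ ^ 2 = N)
    (hc : IsCoprime a b) (hc₀ : IsCoprime a₀ b₀)
    (hg : Int.gcd (a * b₀ - a₀ * b) N = Int.gcd (a₁ * b₀ - a₀ * b₁) N)
    (ha4 : (4 : ℤ) ∣ a - a₁) (hb4 : (4 : ℤ) ∣ b - b₁) : a = a₁ ∧ b = b₁ := by
  have cop : ∀ {x y : ℤ}, IsCoprime x y → x ^ 2 + 3 * y ^ 2 = N → IsCoprime y N := by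
    intro x y hxy hx
    rw [← hx]
    have : IsCoprime y (x ^ 2 + (3 * y) * y) := (hxy.symm.pow_right).add_mul_right_right _
    convert this using 1; ring
  have hbN := cop hc h
  have hb₀N := cop hc₀ h₀
  set e : ℤ := (Int.gcd (a * b₀ - a₀ * b) N : ℤ) with he
  have heu : e ∣ a * b₀ - a₀ * b := Int.gcd_dvd_left ..
  have heu₁ : e ∣ a₁ * b₀ - a₀ * b₁ := by rw [he, hg]; exact Int.gcd_dvd_left ..
  obtain ⟨f, hf⟩ : e ∣ N := Int.gcd_dvd_right ..
  have hepos : e ≠ 0 := by rintro h0; rw [h0] at hf; omega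
  -- the complementary divisor divides the conjugate pairing
  have hcop : ∀ {x y : ℤ}, x ^ 2 + 3 * y ^ 2 = N → e = (Int.gcd (x * b₀ - a₀ * y) N : ℤ) →
      f ∣ x * b₀ + a₀ * y := by
    intro x y hx hex
    have hprod : e * f ∣ (x * b₀ - a₀ * y) * (x * b₀ + a₀ * y) := by
      rw [← hf]
      exact ⟨b₀ ^ 2 - y ^ 2, by linear_combination b₀ ^ 2 * hx - y ^ 2 * h₀⟩
    obtain ⟨s, hs⟩ : e ∣ x * b₀ - a₀ * y := hex ▸ Int.gcd_dvd_left ..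
    have hsf : IsCoprime s f := by
      have hbez := Int.gcd_eq_gcd_ab (x * b₀ - a₀ * y) N
      rw [← hex] at hbez
      refine ⟨Int.gcdA (x * b₀ - a₀ * y) N, Int.gcdB (x * b₀ - a₀ * y) N, ?_⟩
      apply mul_left_cancel₀ hepos
      linear_combination -hbez - Int.gcdA (x * b₀ - a₀ * y) N * hs -
        Int.gcdB (x * b₀ - a₀ * y) N * hf
    rw [hs, mul_assoc] at hprod
    exact hsf.symm.dvd_of_dvd_mul_left ((mul_dvd_mul_iff_left hepos).mp hprod)
  have hfv := hcop h rfl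
  have hfv₁ := hcop h₁ (by rw [he, hg])
  set w := a * b₁ - a₁ * b with hw
  have hew : e ∣ w := by
    have : e ∣ b₀ * w := by
      obtain ⟨k, hk⟩ := dvd_sub (heu.mul_right b₁) (heu₁.mul_right b)
      exact ⟨k, by linear_combination hk⟩
    exact (hb₀N.of_isCoprime_of_dvd_right ⟨f, hf⟩).symm.dvd_of_dvd_mul_left this
  have hfw : f ∣ w := by
    have : f ∣ b₀ * w := by
      obtain ⟨k, hk⟩ := dvd_sub (hfv.mul_right b₁) (hfv₁.mul_right b)
      exact ⟨k, by linear_combination hk⟩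
    exact (hb₀N.of_isCoprime_of_dvd_right ⟨e, by rw [hf]; ring⟩).symm.dvd_of_dvd_mul_left this
  have hg2 : (Int.gcd e f : ℤ) ∣ 2 := by
    subst h
    exact gcd_dvd_two_of_primitive hbN hb₀N hf.symm heu hfv
      (Int.gcd_dvd_left ..) (Int.gcd_dvd_right ..)
  have hN2w : N ∣ 2 * w := by
    have h1 : e * f ∣ (Int.gcd e f : ℤ) * w := by
      rw [Int.gcd_eq_gcd_ab, add_mul]
      apply dvd_add
      · obtain ⟨k, hk⟩ := hfw
        exact ⟨Int.gcdA e f * k, by rw [hk]; ring⟩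
      · obtain ⟨k, hk⟩ := hew
        exact ⟨Int.gcdB e f * k, by rw [hk]; ring⟩
    rw [hf]
    exact h1.trans (mul_dvd_mul_right hg2 w)
  have h4w : (4 : ℤ) ∣ w := by
    obtain ⟨k, hk⟩ := dvd_sub (ha4.mul_right b₁) (hb4.mul_right a₁)
    exact ⟨k, by linear_combination hk⟩
  have hnotboth : ¬ (2 ∣ a ∧ 2 ∣ b) := by
    rintro ⟨h1, h2⟩
    have := hc.isUnit_of_dvd' h1 h2
    revert this; decide
  have hw0 : w = 0 := by
    obtain ⟨k, hk⟩ := hN2w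
    have hnorm : (a * a₁ + 3 * b * b₁) ^ 2 + 3 * w ^ 2 = N ^ 2 := by
      rw [hw]; linear_combination (a₁ ^ 2 + 3 * b₁ ^ 2) * h + N * h₁
    have hk2 : 3 * k ^ 2 ≤ 4 := by
      have h1 : 3 * (2 * w) ^ 2 ≤ 4 * N ^ 2 := by nlinarith [sq_nonneg (a * a₁ + 3 * b * b₁)]
      rw [hk] at h1
      have : N ^ 2 * (3 * k ^ 2) ≤ N ^ 2 * 4 := by linarith
      exact le_of_mul_le_mul_left this (by positivity)
    have hk1 : k ≤ 1 := by nlinarith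
    have hk1' : -1 ≤ k := by nlinarith
    have hcase : k = 0 ∨ k = 1 ∨ k = -1 := by omega
    have h8 : k ≠ 0 → (8 : ℤ) ∣ N := by
      rcases hcase with rfl | rfl | rfl <;> intro _ <;> omega
    rcases eq_or_ne k 0 with rfl | hk0
    · omega
    · exact absurd (even_even_of_eight_dvd (h ▸ h8 hk0)) hnotboth
  have hcol : a * b₁ = a₁ * b := by rw [hw] at hw0; linarith
  have haa : a ^ 2 = a₁ ^ 2 := by
    have : N * a ^ 2 = N * a₁ ^ 2 := by
      calc N * a ^ 2 = (a₁ ^ 2 + 3 * b₁ ^ 2) * a ^ 2 := by rw [h₁]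
        _ = a₁ ^ 2 * a ^ 2 + 3 * (a * b₁) ^ 2 := by ring
        _ = (a ^ 2 + 3 * b ^ 2) * a₁ ^ 2 := by rw [hcol]; ring
        _ = _ := by rw [h]
    exact mul_left_cancel₀ hN.ne' this
  have hbb : b ^ 2 = b₁ ^ 2 := by linarith
  have hab : a * b = a₁ * b₁ := by
    have : N * (a * b) = N * (a₁ * b₁) := by
      calc N * (a * b) = (a₁ ^ 2 + 3 * b₁ ^ 2) * (a * b) := by rw [h₁]
        _ = a₁ * a * (a₁ * b) + 3 * (a * b₁) * b * b₁ := by ring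
        _ = a₁ * a * (a * b₁) + 3 * (a₁ * b) * b * b₁ := by rw [hcol]
        _ = (a ^ 2 + 3 * b ^ 2) * (a₁ * b₁) := by ring
        _ = _ := by rw [h]
    exact mul_left_cancel₀ hN.ne' this
  rcases sq_eq_sq_iff_eq_or_eq_neg.mp haa with h1 | h1 <;>
    rcases sq_eq_sq_iff_eq_or_eq_neg.mp hbb with h2 | h2
  · exact ⟨h1, h2⟩
  · subst h1
    have : a * b₁ = 0 := by rw [h2] at hab; linarith
    rcases mul_eq_zero.mp this with h3 | h3
    · exact absurd ⟨by omega, by omega⟩ hnotboth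
    · exact ⟨rfl, by omega⟩
  · subst h2
    have : a₁ * b = 0 := by rw [h1] at hab; linarith
    rcases mul_eq_zero.mp this with h3 | h3
    · exact ⟨by omega, rfl⟩
    · exact absurd ⟨by omega, by omega⟩ hnotboth
  · exact absurd ⟨by omega, by omega⟩ hnotboth

theorem card_primitive_reps_le {N : ℤ} (hN : 0 < N) (S : Finset (ℤ × ℤ))
    (hS : ∀ p ∈ S, IsCoprime p.1 p.2 ∧ p.1 ^ 2 + 3 * p.2 ^ 2 = N) :
    S.card ≤ 16 * N.natAbs.divisors.card := by
  rcases S.eq_empty_or_nonempty with rfl | ⟨q, hq⟩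
  · simp
  have hcard : (N.natAbs.divisors ×ˢ (Finset.univ : Finset (ZMod 4 × ZMod 4))).card =
      16 * N.natAbs.divisors.card := by
    rw [Finset.card_product, mul_comm]
    rfl
  rw [← hcard]
  apply Finset.card_le_card_of_injOn
    fun p => (Int.gcd (p.1 * q.2 - q.1 * p.2) N, ((p.1 : ZMod 4), (p.2 : ZMod 4)))
  · intro p _
    simp only [Finset.coe_product, Set.mem_prod, Finset.mem_coe, Nat.mem_divisors, Finset.mem_univ,
      and_true]
    exact ⟨Int.natAbs_dvd_natAbs.mpr (Int.gcd_dvd_right ..), by omega⟩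
  · intro p hp p' hp' heq
    simp only [Prod.mk.injEq, ZMod.intCast_eq_intCast_iff_dvd_sub] at heq
    obtain ⟨hg, h1, h2⟩ := heq
    have := primitive_rep_injective hN (hS p hp).2 (hS p' hp').2 (hS q hq).2 (hS p hp).1
      (hS q hq).1 hg ((dvd_sub_comm).mp h1) ((dvd_sub_comm).mp h2)
    exact Prod.ext this.1 this.2

theorem card_reps_le {N : ℤ} (hN : 0 < N) (S : Finset (ℤ × ℤ))
    (hS : ∀ p ∈ S, p.1 ^ 2 + 3 * p.2 ^ 2 = N) :
    S.card ≤ 16 * N.natAbs.divisors.card ^ 2 := by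
  have hgN : ∀ p ∈ S, (Int.gcd p.1 p.2 : ℤ) ^ 2 ∣ N := by
    intro p hp
    rw [← hS p hp]
    exact dvd_add (pow_dvd_pow_of_dvd (Int.gcd_dvd_left ..) 2)
      ((pow_dvd_pow_of_dvd (Int.gcd_dvd_right ..) 2).mul_left 3)
  have himg : (S.image fun p => Int.gcd p.1 p.2).card ≤ N.natAbs.divisors.card := by
    refine Finset.card_le_card fun g hg => ?_
    obtain ⟨p, hp, rfl⟩ := Finset.mem_image.mp hg
    refine Nat.mem_divisors.mpr ⟨Int.natCast_dvd.mp ?_, by omega⟩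
    exact (dvd_pow_self _ two_ne_zero).trans (hgN p hp)
  have hfib : ∀ g ∈ S.image (fun p => Int.gcd p.1 p.2),
      (S.filter fun p => Int.gcd p.1 p.2 = g).card ≤ 16 * N.natAbs.divisors.card := by
    intro g hg
    obtain ⟨q, hq, rfl⟩ := Finset.mem_image.mp hg
    set g := Int.gcd q.1 q.2
    obtain ⟨M, hM⟩ := hgN q hq
    have hg0 : (g : ℤ) ≠ 0 := by rintro h0; rw [h0] at hM; simp at hM; omega
    have hMpos : 0 < M := by
      rw [hM] at hN
      exact pos_of_mul_pos_right hN (by positivity)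
    have hdiv : ∀ p : ℤ × ℤ, Int.gcd p.1 p.2 = g →
        (g : ℤ) * (p.1 / g) = p.1 ∧ (g : ℤ) * (p.2 / g) = p.2 := by
      intro p hp
      rw [← hp]
      exact ⟨Int.mul_ediv_cancel' (Int.gcd_dvd_left ..), Int.mul_ediv_cancel' (Int.gcd_dvd_right ..)⟩
    have hinj : Set.InjOn (fun p : ℤ × ℤ => (p.1 / (g : ℤ), p.2 / (g : ℤ)))
        (S.filter fun p => Int.gcd p.1 p.2 = g) := by
      intro p hp p' hp' heq
      have h1 := hdiv p (Finset.mem_filter.mp hp).2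
      have h2 := hdiv p' (Finset.mem_filter.mp hp').2
      simp only [Prod.mk.injEq] at heq
      exact Prod.ext (by rw [← h1.1, ← h2.1, heq.1]) (by rw [← h1.2, ← h2.2, heq.2])
    rw [← Finset.card_image_of_injOn hinj]
    refine (card_primitive_reps_le hMpos _ ?_).trans ?_
    · intro r hr
      obtain ⟨p, hp, rfl⟩ := Finset.mem_image.mp hr
      obtain ⟨hpS, hpg⟩ := Finset.mem_filter.mp hp
      obtain ⟨h1, h2⟩ := hdiv p hpg
      constructor
      · rw [Int.isCoprime_iff_gcd_eq_one]
        have := Int.gcd_ediv_gcd_ediv_gcd (i := p.1) (j := p.2) (by rw [hpg]; omega)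
        rwa [hpg] at this
      · have := hS p hpS
        rw [← h1, ← h2, hM] at this
        apply mul_left_cancel₀ (pow_ne_zero 2 hg0)
        linear_combination this
    · exact Nat.mul_le_mul_left _ (Finset.card_le_card (Nat.divisors_subset_of_dvd (by omega)
        (Int.natAbs_dvd_natAbs.mpr ⟨_, hM.trans (mul_comm _ _)⟩)))
  calc S.card ≤ (16 * N.natAbs.divisors.card) * (S.image fun p => Int.gcd p.1 p.2).card :=
        Finset.card_le_mul_card_image S _ hfib
    _ ≤ (16 * N.natAbs.divisors.card) * N.natAbs.divisors.card := by gcongr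
    _ = _ := by ring

/-- The real cubic `y³ - 3Iy - J` has its real roots bounded in terms of the height. -/
theorem abs_root_le {Z I J y : ℝ} (hZ : 0 < Z) (hI : |I| ≤ Z ^ 2) (hJ : |J| ≤ 2 * Z ^ 3)
    (h : J = y ^ 3 - 3 * I * y) : |y| ≤ 2 * Z := by
  by_contra! hlt
  have h1 : |y| ^ 3 ≤ 2 * Z ^ 3 + 3 * Z ^ 2 * |y| := by
    calc |y| ^ 3 = |J + 3 * I * y| := by rw [← abs_pow, h]; congr 1; ring
      _ ≤ |J| + |3 * I * y| := abs_add_le _ _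
      _ = |J| + 3 * |I| * |y| := by rw [abs_mul, abs_mul]; simp
      _ ≤ _ := by gcongr
  nlinarith [mul_pos (sub_pos.mpr hlt) (show 0 < (|y| + Z) ^ 2 by positivity)]

theorem card_Icc_floor_le {r s : ℝ} (hr : 0 ≤ r) (hs : 2 * r + 1 ≤ s) :
    ((Finset.Icc (-⌊r⌋) ⌊r⌋).card : ℝ) ≤ s := by
  have h0 : 0 ≤ ⌊r⌋ := Int.floor_nonneg.mpr hr
  have : ((Finset.Icc (-⌊r⌋) ⌊r⌋).card : ℤ) = 2 * ⌊r⌋ + 1 := by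
    rw [Int.card_Icc]; omega
  have h2 : ((Finset.Icc (-⌊r⌋) ⌊r⌋).card : ℝ) = 2 * (⌊r⌋ : ℝ) + 1 := by exact_mod_cast this
  rw [h2]
  linarith [Int.floor_le r]

theorem mem_Icc_floor {r : ℝ} {x : ℤ} (h : |(x : ℝ)| ≤ r) : x ∈ Finset.Icc (-⌊r⌋) ⌊r⌋ := by
  obtain ⟨h1, h2⟩ := abs_le.mp h
  rw [Finset.mem_Icc]
  refine ⟨?_, Int.le_floor.mpr h2⟩
  have : -x ≤ ⌊r⌋ := Int.le_floor.mpr (by push_cast; linarith)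
  omega

theorem card_reducible_le {Z : ℝ} (hZ : 1 ≤ Z) (S : Finset (ℤ × ℤ))
    (hS : ∀ p ∈ S, |(p.1 : ℝ)| ≤ Z ^ 2 ∧ |(p.2 : ℝ)| ≤ 2 * Z ^ 3 ∧
      ∃ y : ℤ, p.2 = y ^ 3 - 3 * p.1 * y) : (S.card : ℝ) ≤ 15 * Z ^ 3 := by
  have hsub : S ⊆ (Finset.Icc (-⌊Z ^ 2⌋) ⌊Z ^ 2⌋ ×ˢ Finset.Icc (-⌊2 * Z⌋) ⌊2 * Z⌋).image
      fun q => (q.1, q.2 ^ 3 - 3 * q.1 * q.2) := by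
    intro p hp
    obtain ⟨hI, hJ, y, hy⟩ := hS p hp
    refine Finset.mem_image.mpr ⟨(p.1, y), Finset.mem_product.mpr
      ⟨mem_Icc_floor hI, mem_Icc_floor ?_⟩, Prod.ext rfl hy.symm⟩
    exact abs_root_le (by linarith) hI hJ (by exact_mod_cast hy)
  have hcard := (Finset.card_le_card hsub).trans Finset.card_image_le
  rw [Finset.card_product] at hcard
  calc (S.card : ℝ) ≤ ((Finset.Icc (-⌊Z ^ 2⌋) ⌊Z ^ 2⌋).card : ℝ) *
          ((Finset.Icc (-⌊2 * Z⌋) ⌊2 * Z⌋).card : ℝ) := by exact_mod_cast hcard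
    _ ≤ (3 * Z ^ 2) * (5 * Z) := by
        gcongr
        · exact card_Icc_floor_le (by positivity) (by nlinarith)
        · exact card_Icc_floor_le (by positivity) (by linarith)
    _ = _ := by ring

theorem card_square_discr_le {C δ Z : ℝ} (hC : 0 ≤ C) (hδ : 0 < δ) (hZ : 1 ≤ Z)
    (hdiv : ∀ n : ℕ, n ≠ 0 → (n.divisors.card : ℝ) ≤ C * (n : ℝ) ^ δ) (S : Finset (ℤ × ℤ))
    (hS : ∀ p ∈ S, |(p.1 : ℝ)| ≤ Z ^ 2 ∧ p.1 ≠ 0 ∧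
      ∃ m : ℤ, p.2 ^ 2 + 3 * m ^ 2 = 4 * p.1 ^ 3) :
    (S.card : ℝ) ≤ 48 * Z ^ 2 * (C * (4 * Z ^ 6) ^ δ) ^ 2 := by
  set D : ℝ := C * (4 * Z ^ 6) ^ δ with hD
  have hD0 : 0 ≤ D := by positivity
  have hfib : ∀ I ∈ S.image Prod.fst,
      (S.filter fun p => p.1 = I).card ≤ ⌊16 * D ^ 2⌋₊ := by
    intro I hI
    obtain ⟨q, hq, rfl⟩ := Finset.mem_image.mp hI
    obtain ⟨hq1, hq0, m, hm⟩ := hS q hq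
    have hpos : 0 < 4 * q.1 ^ 3 := by
      have h0 : 0 ≤ 4 * q.1 ^ 3 := hm ▸ by positivity
      exact lt_of_le_of_ne h0 (Ne.symm (by positivity))
    choose! m hm using fun p hp => (hS p hp).2.2
    apply Nat.le_floor
    set T := S.filter fun p => p.1 = q.1
    have hinj : Set.InjOn (fun p : ℤ × ℤ => (p.2, m p)) T := by
      intro p hp p' hp' h
      exact Prod.ext ((Finset.mem_filter.mp hp).2.trans (Finset.mem_filter.mp hp').2.symm)
        (Prod.mk.inj h).1
    have hle := card_reps_le hpos (T.image fun p => (p.2, m p)) (by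
      intro r hr
      obtain ⟨p, hp, rfl⟩ := Finset.mem_image.mp hr
      obtain ⟨hpS, hpI⟩ := Finset.mem_filter.mp hp
      rw [← hpI]; exact hm p hpS)
    rw [Finset.card_image_of_injOn hinj] at hle
    have hN : ((4 * q.1 ^ 3).natAbs : ℝ) ≤ 4 * Z ^ 6 := by
      rw [Nat.cast_natAbs, Int.cast_abs]
      push_cast
      rw [abs_mul, abs_pow, abs_of_pos (by norm_num : (0 : ℝ) < 4)]
      calc 4 * |(q.1 : ℝ)| ^ 3 ≤ 4 * (Z ^ 2) ^ 3 := by gcongr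
        _ = _ := by ring
    calc (T.card : ℝ) ≤ 16 * ((4 * q.1 ^ 3).natAbs.divisors.card : ℝ) ^ 2 := by exact_mod_cast hle
      _ ≤ 16 * D ^ 2 := by
        gcongr
        exact (hdiv _ (by omega)).trans (by rw [hD]; gcongr)
  have himg : ((S.image Prod.fst).card : ℝ) ≤ 3 * Z ^ 2 := by
    refine le_trans ?_ (card_Icc_floor_le (r := Z ^ 2) (by positivity) (by nlinarith))
    exact_mod_cast Finset.card_le_card fun I hI => by
      obtain ⟨p, hp, rfl⟩ := Finset.mem_image.mp hI
      exact mem_Icc_floor (hS p hp).1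
  calc (S.card : ℝ) ≤ (⌊16 * D ^ 2⌋₊ : ℝ) * ((S.image Prod.fst).card : ℝ) := by
        exact_mod_cast Finset.card_le_mul_card_image S _ hfib
    _ ≤ (16 * D ^ 2) * (3 * Z ^ 2) := by
        gcongr
        exact Nat.floor_le (by positivity)
    _ = _ := by ring

theorem mRel_of_invariants_eq {n : ℤ} (hn : n ≠ 0) {t t' : ℤ × ℤ × ℤ}
    (hb : t.1 % (3 * n) = t'.1 % (3 * n)) (hI : Iform n t.1 t.2.1 = Iform n t'.1 t'.2.1)
    (hJ : Jform n t.1 t.2.1 t.2.2 = Jform n t'.1 t'.2.1 t'.2.2) : mRel n t t' := by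
  obtain ⟨b, c, d⟩ := t
  obtain ⟨b', c', d'⟩ := t'
  obtain ⟨k, hk⟩ := Int.ModEq.dvd hb
  simp only [Iform, Jform] at hI hJ hk
  obtain rfl : b' = b + 3 * n * k := by linarith
  have hc : c' = c + 2 * b * k + 3 * n * k ^ 2 := by
    apply mul_left_cancel₀ (mul_ne_zero three_ne_zero hn)
    linear_combination hI
  subst hc
  have hd : d' = d + c * k + b * k ^ 2 + n * k ^ 3 := by
    apply mul_left_cancel₀ (mul_ne_zero (by norm_num : (27 : ℤ) ≠ 0) (pow_ne_zero 2 hn))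
    linear_combination hJ
  subst hd
  exact ⟨k, rfl⟩

theorem invariants_le_of_htForm_lt {n : ℕ} (hn : 0 < n) {b c d : ℤ} {X Z : ℝ} (hZ : 0 ≤ Z)
    (hZX : Z ^ 6 = (n : ℝ) ^ 2 * X) (h : htForm n b c d < X) :
    |(Iform n b c : ℝ)| ≤ Z ^ 2 ∧ |(Jform n b c d : ℝ)| ≤ 2 * Z ^ 3 := by
  have hn' : (0 : ℝ) < (n : ℝ) ^ 2 := by positivity
  have hmax : max (|(Iform n b c : ℝ)| ^ 3) ((Jform n b c d : ℝ) ^ 2 / 4) < Z ^ 6 := by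
    rw [hZX]
    have := mul_lt_mul_of_pos_left h hn'
    simpa [htForm, mul_inv_cancel_left₀ hn'.ne'] using this
  obtain ⟨h1, h2⟩ := max_lt_iff.mp hmax
  constructor
  · apply le_of_lt
    apply lt_of_pow_lt_pow_left₀ 3 (by positivity)
    calc _ < Z ^ 6 := h1
      _ = _ := by ring
  · apply abs_le_of_sq_le_sq _ (by positivity)
    nlinarith

theorem ncard_orbits_le {n : ℕ} (hn : 0 < n) {C δ X Z : ℝ} (hC : 0 ≤ C) (hδ : 0 < δ)
    (hZ : 1 ≤ Z) (hZX : Z ^ 6 = (n : ℝ) ^ 2 * X)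
    (hdiv : ∀ n : ℕ, n ≠ 0 → (n.divisors.card : ℝ) ≤ C * (n : ℝ) ^ δ) :
    (Set.ncard {q : Quot (mRel n) | ∃ t : ℤ × ℤ × ℤ,
          Quot.mk _ t = q ∧ htForm n t.1 t.2.1 t.2.2 < X ∧
          ¬ GenericForm n t.1 t.2.1 t.2.2} : ℝ) ≤
      3 * n * (15 * Z ^ 3 + 48 * Z ^ 2 * (C * (4 * Z ^ 6) ^ δ) ^ 2) := by
  classical
  have hn0 : (n : ℤ) ≠ 0 := by omega
  set box := Finset.Icc (-⌊Z ^ 2⌋) ⌊Z ^ 2⌋ ×ˢ Finset.Icc (-⌊2 * Z ^ 3⌋) ⌊2 * Z ^ 3⌋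
  set S₁ := box.filter fun p => |(p.1 : ℝ)| ≤ Z ^ 2 ∧ |(p.2 : ℝ)| ≤ 2 * Z ^ 3 ∧
      ∃ y : ℤ, p.2 = y ^ 3 - 3 * p.1 * y
  set S₂ := box.filter fun p => |(p.1 : ℝ)| ≤ Z ^ 2 ∧ p.1 ≠ 0 ∧
      ∃ m : ℤ, p.2 ^ 2 + 3 * m ^ 2 = 4 * p.1 ^ 3
  have hc₁ := card_reducible_le hZ S₁ fun p hp => (Finset.mem_filter.mp hp).2
  have hc₂ := card_square_discr_le hC hδ hZ hdiv S₂ fun p hp => (Finset.mem_filter.mp hp).2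
  set T := Finset.Ico (0 : ℤ) (3 * n) ×ˢ (S₁ ∪ S₂) with hT
  set Q := {q : Quot (mRel n) | ∃ t : ℤ × ℤ × ℤ, Quot.mk _ t = q ∧
    htForm n t.1 t.2.1 t.2.2 < X ∧ ¬ GenericForm n t.1 t.2.1 t.2.2}
  have hQ' : ∀ q ∈ Q, ∃ t : ℤ × ℤ × ℤ, Quot.mk _ t = q ∧
    htForm n t.1 t.2.1 t.2.2 < X ∧ ¬ GenericForm n t.1 t.2.1 t.2.2 := fun q hq => hq
  choose! rep hrep hht hgen using hQ'
  have hle : Q.ncard ≤ (T : Set (ℤ × ℤ × ℤ)).ncard := by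
    apply Set.ncard_le_ncard_of_injOn (fun q => ((rep q).1 % (3 * n),
      Iform n (rep q).1 (rep q).2.1, Jform n (rep q).1 (rep q).2.1 (rep q).2.2))
    · intro q hq
      obtain ⟨hI, hJ⟩ := invariants_le_of_htForm_lt hn (by linarith) hZX (hht q hq)
      have hbox : (Iform n (rep q).1 (rep q).2.1, Jform n (rep q).1 (rep q).2.1 (rep q).2.2) ∈ box :=
        Finset.mem_product.mpr ⟨mem_Icc_floor hI, mem_Icc_floor hJ⟩
      refine Finset.mem_coe.mpr (Finset.mem_product.mpr ⟨Finset.mem_Ico.mpr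
        ⟨Int.emod_nonneg _ (by omega), Int.emod_lt_of_pos _ (by omega)⟩, ?_⟩)
      rcases not_generic_imp hn0 (hgen q hq) with hy | ⟨m, hm⟩
      · exact Finset.mem_union_left _ (Finset.mem_filter.mpr ⟨hbox, hI, hJ, hy⟩)
      · by_cases h0 : Iform n (rep q).1 (rep q).2.1 = 0
        · refine Finset.mem_union_left _ (Finset.mem_filter.mpr ⟨hbox, hI, hJ, 0, ?_⟩)
          rw [h0] at hm
          have : Jform n (rep q).1 (rep q).2.1 (rep q).2.2 ^ 2 = 0 := by
            nlinarith [sq_nonneg m, sq_nonneg (Jform n (rep q).1 (rep q).2.1 (rep q).2.2)]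
          simpa using this
        · exact Finset.mem_union_right _ (Finset.mem_filter.mpr ⟨hbox, hI, h0, m, hm⟩)
    · intro q hq q' hq' heq
      simp only [Prod.mk.injEq] at heq
      rw [← hrep q hq, ← hrep q' hq']
      exact Quot.sound (mRel_of_invariants_eq hn0 heq.1 heq.2.1 heq.2.2)
  rw [Set.ncard_coe_finset, hT, Finset.card_product, Int.card_Ico] at hle
  have hle' : Q.ncard ≤ 3 * n * (S₁.card + S₂.card) := by
    refine hle.trans (Nat.mul_le_mul (by omega) (Finset.card_union_le _ _))
  calc (Q.ncard : ℝ) ≤ 3 * n * (S₁.card + S₂.card) := by exact_mod_cast hle'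
    _ ≤ _ := by gcongr

/-- Lemma 26 of the paper: for fixed `n ≥ 1` and every `ε > 0`
there is `κ > 0` (depending only on `n` and `ε`) such that the number of
`M(ℤ)`-orbits on `U_n(ℤ)` containing a non-generic form of height `< X` is at most
`κ·X^{1/2+ε}` for all `X ≥ 1`. -/
theorem count_nongeneric_orbits (n : ℕ) (hn : 0 < n) (ε : ℝ) (hε : 0 < ε) :
    ∃ κ : ℝ, 0 < κ ∧ ∀ X : ℝ, 1 ≤ X →
      (Set.ncard {q : Quot (mRel n) | ∃ t : ℤ × ℤ × ℤ,
          Quot.mk _ t = q ∧ htForm n t.1 t.2.1 t.2.2 < X ∧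
          ¬ GenericForm n t.1 t.2.1 t.2.2} : ℝ) ≤
        κ * X ^ ((1 : ℝ) / 2 + ε) := by
  obtain ⟨C, hC, hdiv⟩ := exists_card_divisors_le (half_pos hε)
  have hn1 : (1 : ℝ) ≤ n := by exact_mod_cast hn
  refine ⟨3 * n * (15 * n + 48 * n * (C ^ 2 * (4 * (n : ℝ) ^ 2) ^ ε)), by positivity,
    fun X hX => ?_⟩
  have hnX : 1 ≤ (n : ℝ) ^ 2 * X := one_le_mul_of_one_le_of_one_le (one_le_pow₀ hn1) hX
  set Z : ℝ := ((n : ℝ) ^ 2 * X) ^ ((1 : ℝ) / 6) with hZdef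
  have hZ : 1 ≤ Z := Real.one_le_rpow hnX (by norm_num)
  have hZ6 : Z ^ 6 = (n : ℝ) ^ 2 * X := by
    rw [hZdef, ← Real.rpow_natCast, ← Real.rpow_mul (by positivity)]
    norm_num
  have hZ3 : Z ^ 3 = n * X ^ ((1 : ℝ) / 2) := by
    have h : (Z ^ 3) ^ 2 = (n * X ^ ((1 : ℝ) / 2)) ^ 2 := by
      rw [← pow_mul, hZ6, mul_pow, ← Real.rpow_natCast (X ^ ((1 : ℝ) / 2)),
        ← Real.rpow_mul (by positivity)]
      norm_num
    exact (pow_left_inj₀ (by positivity) (by positivity) two_ne_zero).mp h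
  have hXε : 1 ≤ X ^ ε := Real.one_le_rpow hX hε.le
  have hpow : (C * (4 * Z ^ 6) ^ (ε / 2)) ^ 2 = C ^ 2 * (4 * (n : ℝ) ^ 2) ^ ε * X ^ ε := by
    rw [mul_pow, hZ6, ← mul_assoc, ← Real.rpow_natCast ((4 * (n : ℝ) ^ 2 * X) ^ (ε / 2)),
      ← Real.rpow_mul (by positivity), Nat.cast_ofNat, div_mul_cancel₀ _ two_ne_zero,
      Real.mul_rpow (by positivity) (by positivity), mul_assoc]
  refine (ncard_orbits_le hn hC.le (half_pos hε) hZ hZ6 hdiv).trans ?_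
  rw [hpow, Real.rpow_add (by linarith)]
  calc 3 * (n : ℝ) * (15 * Z ^ 3 + 48 * Z ^ 2 * (C ^ 2 * (4 * (n : ℝ) ^ 2) ^ ε * X ^ ε))
      ≤ 3 * n * (15 * (Z ^ 3 * X ^ ε) +
          48 * Z ^ 3 * (C ^ 2 * (4 * (n : ℝ) ^ 2) ^ ε * X ^ ε)) := by
        gcongr
        · exact le_mul_of_one_le_right (by positivity) hXε
        · norm_num
    _ = _ := by rw [hZ3]; ring
end
end
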